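/- arXiv:2102.08723 — 3 statements merged into one kernel-verified Lean document; each statement's English description precedes it below -/
import Mathlib

section
/- Let n ≥ 3, 0 < α < 1, ζ > 0 and ζ' > 0. Let f : ℝⁿ → ℝ be α-Hölder continuous on every compact set, with finite limit f(∞) = lim_{|x|→∞} f(x), satisfying limsup_{|x|→∞} ( |x|^ζ |f(x) − f(∞)| + |x|^{α+ζ'} [f]_{C^α(B̄_{|x|/2}(x))} ) < ∞. Let u ∈ C²(ℝⁿ) satisfy −√2 Σᵢ 1/(1+λᵢ(D²u(x))) = f(x) for all x ∈ ℝⁿ, with u(x) ≤ C(1+|x|²) for all x for some constant C and D²u(x) + I positive definite for every x. Then there exist ε > 0, C' > 0 and a symmetric n×n matrix A with A + I positive definite and −√2 Σᵢ 1/(1+λᵢ(A)) = f(∞), such that sup_{ℝⁿ}|D²u| + [D²u]_{C^α(ℝⁿ)} ≤ C' and |D²u(x) − A| ≤ C' |x|^{−ε} for all |x| ≥ 1. -/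
open Filter

/-- The Hessian matrix `(∂ᵢ∂ⱼ u(x))` of a function on Euclidean space. -/
noncomputable def hess {n : ℕ} (u : EuclideanSpace ℝ (Fin n) → ℝ)
    (x : EuclideanSpace ℝ (Fin n)) : Matrix (Fin n) (Fin n) ℝ :=
  Matrix.of fun i j =>
    iteratedFDeriv ℝ 2 u x ![EuclideanSpace.single i 1, EuclideanSpace.single j 1]

open MeasureTheory
open scoped ContDiff Matrix


abbrev EE (n : ℕ) := EuclideanSpace ℝ (Fin n)

noncomputable def pd {n : ℕ} (k : Fin n) (g : EE n → ℝ) (z : EE n) : ℝ :=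
  fderiv ℝ g z (EuclideanSpace.single k 1)

theorem contDiff_primitive {b : ℝ → ℝ} (hb : ContDiff ℝ ∞ b) (a : ℝ) :
    ContDiff ℝ ∞ (fun t => ∫ s in a..t, b s) ∧ ∀ t, HasDerivAt (fun t => ∫ s in a..t, b s) (b t) t := by
  have h : ∀ t, HasDerivAt (fun t => ∫ s in a..t, b s) (b t) t := fun t =>
    intervalIntegral.integral_hasDerivAt_right (hb.continuous.intervalIntegrable _ _)
      (hb.continuous.stronglyMeasurableAtFilter _ _) hb.continuous.continuousAt
  refine ⟨contDiff_infty_iff_deriv.2 ⟨fun t => (h t).differentiableAt, ?_⟩, h⟩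
  have : deriv (fun t => ∫ s in a..t, b s) = b := funext fun t => (h t).deriv
  rw [this]; exact hb

theorem pd_radial {n : ℕ} {H : ℝ → ℝ} {d : ℝ} {z : EE n} (hH : HasDerivAt H d (‖z‖ ^ 2)) (k : Fin n) :
    pd k (fun z => H (‖z‖ ^ 2)) z = d * (2 * z k) := by
  have h1 := (hasStrictFDerivAt_norm_sq z).hasFDerivAt
  have h2 := hH.comp_hasFDerivAt z h1
  have h3 : (H ∘ fun z : EE n => ‖z‖ ^ 2) = fun z => H (‖z‖ ^ 2) := rfl
  rw [h3] at h2
  unfold pd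
  rw [h2.fderiv]
  simp [EuclideanSpace.inner_single_right]

theorem rpow_cut_contDiff (p : ℝ) {c : ℝ → ℝ} (hc : ContDiff ℝ ∞ c) (h0 : ∀ t, t ≤ 1 → c t = 0) :
    ContDiff ℝ ∞ (fun t : ℝ => t ^ p * c t) := by
  rw [contDiff_iff_contDiffAt]
  intro t
  by_cases ht : 0 < t
  · exact (Real.contDiffAt_rpow_const_of_ne ht.ne').mul hc.contDiffAt
  · have : (fun t : ℝ => t ^ p * c t) =ᶠ[nhds t] fun _ => 0 := by
      filter_upwards [Iio_mem_nhds (show t < 1 by linarith)] with s hs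
      rw [h0 s (le_of_lt hs), mul_zero]
    exact contDiffAt_const.congr_of_eventuallyEq this

theorem exists_kernel0 (n : ℕ) : ∃ φ Ψ : EE n → ℝ, 
    ContDiff ℝ ∞ φ ∧ ContDiff ℝ ∞ Ψ ∧ (∀ z, 3 ≤ ‖z‖ → φ z = 0) ∧ (∀ z, 3 ≤ ‖z‖ → Ψ z = 0) ∧
    (∀ z, 0 ≤ φ z) ∧ (0 < n → ∃ z, φ z ≠ 0) ∧
    ∀ z, ∑ k, pd k (pd k Ψ) z = (2⁻¹ : ℝ) ^ n * φ ((2⁻¹ : ℝ) • z) - φ z := by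
  set χ : ℝ → ℝ := fun t => Real.smoothTransition (t - 1) with hχ
  have χs : ContDiff ℝ ∞ χ := Real.smoothTransition.contDiff.comp (contDiff_id.sub contDiff_const)
  have χ0 : ∀ t, t ≤ 1 → χ t = 0 := fun t ht => Real.smoothTransition.zero_of_nonpos (by linarith)
  have χ1 : ∀ t, 2 ≤ t → χ t = 1 := fun t ht => Real.smoothTransition.one_of_one_le (by linarith)
  have χm : Monotone χ := fun a b hab => Real.smoothTransition.monotone (by linarith)
  set b := deriv χ with hb
  have bs : ContDiff ℝ ∞ b := (contDiff_infty_iff_deriv.1 χs).2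
  have χd : ∀ t, HasDerivAt χ (b t) t := fun t =>
    ((contDiff_infty_iff_deriv.1 χs).1 t).hasDerivAt
  have bnn : ∀ t, 0 ≤ b t := fun t => χm.deriv_nonneg
  have b0 : ∀ t, t ≤ 1 → b t = 0 := by
    have h1 : Set.EqOn b (fun _ => 0) (Set.Iio 1) := by
      intro t ht
      have : χ =ᶠ[nhds t] fun _ => 0 := by
        filter_upwards [Iio_mem_nhds ht] with s hs using χ0 s (le_of_lt hs)
      rw [hb, this.deriv_eq]; simp
    have h2 := h1.closure bs.continuous continuous_const
    rw [closure_Iio] at h2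
    exact fun t ht => h2 ht
  have b1 : ∀ t, 2 < t → b t = 0 := by
    intro t ht
    have : χ =ᶠ[nhds t] fun _ => 1 := by
      filter_upwards [Ioi_mem_nhds ht] with s hs using χ1 s (le_of_lt hs)
    rw [hb, this.deriv_eq]; simp
  set c : ℝ → ℝ := fun t => χ t - χ (t / 4) with hc
  have cs : ContDiff ℝ ∞ c := χs.sub (χs.comp (contDiff_id.div_const 4))
  have c0 : ∀ t, t ≤ 1 → c t = 0 := fun t ht => by
    simp only [hc]; rw [χ0 t ht, χ0 (t/4) (by linarith)]; simp
  have c1 : ∀ t, 8 ≤ t → c t = 0 := fun t ht => by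
    simp only [hc]; rw [χ1 t (by linarith), χ1 (t/4) (by linarith)]; simp
  have cd : ∀ t, HasDerivAt c (b t - b (t / 4) / 4) t := fun t => by
    have h1 : HasDerivAt (fun t : ℝ => t / 4) (1 / 4) t := (hasDerivAt_id t).div_const 4
    have := (χd t).sub ((χd (t / 4)).comp t h1)
    have e : b t - b (t / 4) / 4 = b t - b (t / 4) * (1 / 4) := by ring
    rw [e]; exact this
  set m : ℝ → ℝ := fun t => t ^ (-(n / 2 : ℝ)) * c t with hm
  have ms : ContDiff ℝ ∞ m := rpow_cut_contDiff _ cs c0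
  obtain ⟨Hs, Hd⟩ := contDiff_primitive ms 9
  set H : ℝ → ℝ := fun t => ∫ s in (9:ℝ)..t, m s
  set q : ℝ → ℝ := fun t => t ^ (1 - (n / 2 : ℝ)) * b t with hq
  have qs : ContDiff ℝ ∞ q := rpow_cut_contDiff _ bs b0
  have nsq : ContDiff ℝ ∞ (fun z : EE n => ‖z‖ ^ 2) := contDiff_norm_sq ℝ
  have nle : ∀ z : EE n, 3 ≤ ‖z‖ → 9 ≤ ‖z‖ ^ 2 := fun z hz => by nlinarith
  refine ⟨fun z => 4 * q (‖z‖ ^ 2), fun z => - H (‖z‖ ^ 2), contDiff_const.mul (qs.comp nsq),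
    (Hs.comp nsq).neg, ?_, ?_, ?_, ?_, ?_⟩
  · intro z hz
    simp only [hq]
    rw [b1 _ (by linarith [nle z hz])]; simp
  · intro z hz
    have : H (‖z‖ ^ 2) = ∫ s in (9:ℝ)..‖z‖ ^ 2, (0:ℝ) := by
      apply intervalIntegral.integral_congr
      intro s hs
      rw [Set.uIcc_of_le (nle z hz)] at hs
      simp only [hm]
      rw [c1 s (by linarith [hs.1])]; simp
    simp only [this]; simp
  · intro z
    have := mul_nonneg (Real.rpow_nonneg (sq_nonneg ‖z‖) (1 - (n / 2 : ℝ))) (bnn (‖z‖ ^ 2))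
    simp only [hq]; linarith
  · intro hn
    obtain ⟨t, ht, hbt⟩ := exists_deriv_eq_slope χ (show (1:ℝ) < 2 by norm_num) χs.continuous.continuousOn
      (fun t _ => (χd t).differentiableAt.differentiableWithinAt)
    rw [χ1 2 le_rfl, χ0 1 le_rfl] at hbt
    have ht0 : 0 < t := by linarith [ht.1]
    refine ⟨EuclideanSpace.single ⟨0, hn⟩ (Real.sqrt t), ?_⟩
    have : ‖(EuclideanSpace.single ⟨0, hn⟩ (Real.sqrt t) : EE n)‖ ^ 2 = t := by
      simp [Real.sq_sqrt ht0.le]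
    simp only [this, hq, hb, hbt]
    have := Real.rpow_pos_of_pos ht0 (1 - (n / 2 : ℝ))
    norm_num
    exact this.ne'
  · intro z
    have h1 : ∀ k : Fin n, pd k (fun z => - H (‖z‖ ^ 2)) = fun z => (-m (‖z‖ ^ 2)) * (2 * z k) := by
      intro k; funext z
      have := pd_radial (H := fun t => - H t) (Hd (‖z‖ ^ 2)).neg k
      exact this
    set m' := deriv m (‖z‖ ^ 2) with hm'
    have md : HasDerivAt m m' (‖z‖ ^ 2) := ((contDiff_infty_iff_deriv.1 ms).1 _).hasDerivAt
    have h2 : ∀ k : Fin n, pd k (pd k (fun z => - H (‖z‖ ^ 2))) z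
        = -m (‖z‖^2) * 2 - 4 * m' * z k ^ 2 := by
      intro k
      rw [h1]
      have e1 : HasFDerivAt (fun z : EE n => -m (‖z‖ ^ 2)) (fderiv ℝ (fun z : EE n => -m (‖z‖ ^ 2)) z) z :=
        ((((contDiff_infty_iff_deriv.1 ms).1.comp (nsq.differentiable (by simp))).neg) z).hasFDerivAt
      have e2 : HasFDerivAt (fun z : EE n => 2 * z k) ((2:ℝ) • EuclideanSpace.proj k) z := 
        ((EuclideanSpace.proj (𝕜 := ℝ) k : EE n →L[ℝ] ℝ).hasFDerivAt (x := z)).const_mul 2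
      have e3 := pd_radial (H := fun t => - m t) md.neg k
      unfold pd at e3 ⊢
      have e5 : HasFDerivAt (fun z : EE n => -m (‖z‖ ^ 2) * (2 * z k)) _ z := e1.mul e2
      rw [e5.fderiv]
      simp only [add_apply, smul_apply, smul_eq_mul, e3]
      simp
      ring
    rw [Finset.sum_congr rfl fun k _ => h2 k, Finset.sum_sub_distrib, ← Finset.mul_sum, ← Finset.mul_sum]
    have h3 : ∑ k, z k ^ 2 = ‖z‖ ^ 2 := (EuclideanSpace.real_norm_sq_eq z).symm
    rw [h3]
    have h4 : ‖(2⁻¹ : ℝ) • z‖ ^ 2 = ‖z‖ ^ 2 / 4 := by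
      rw [norm_smul]; norm_num; ring
    simp only [h4, Finset.sum_const, Finset.card_univ, Fintype.card_fin, nsmul_eq_mul]
    set t := ‖z‖ ^ 2 with ht
    rcases lt_or_ge 0 t with hpos | hneg
    · have md2 : HasDerivAt m (-(n/2:ℝ) * t ^ (-(n/2:ℝ) - 1) * c t + t ^ (-(n/2:ℝ)) * (b t - b (t/4)/4)) t := by
        exact (Real.hasDerivAt_rpow_const (Or.inl hpos.ne')).mul (cd t)
      rw [md.unique md2]
      simp only [hm, hq]
      have r1 : t ^ (-(n/2:ℝ) - 1) = t ^ (-(n/2:ℝ)) / t := by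
        rw [Real.rpow_sub hpos, Real.rpow_one]
      have r2 : t ^ (1 - (n/2:ℝ)) = t ^ (-(n/2:ℝ)) * t := by
        rw [sub_eq_add_neg, add_comm, Real.rpow_add hpos, Real.rpow_one]
      have r3 : (t/4) ^ (1 - (n/2:ℝ)) = t ^ (-(n/2:ℝ)) * t * (2 ^ n / 4) := by
        rw [Real.div_rpow hpos.le (by norm_num), r2]
        have : (4:ℝ) ^ (1 - (n/2:ℝ)) = 4 / 2 ^ n := by
          rw [Real.rpow_sub (by norm_num), Real.rpow_one]
          congr 1
          rw [show (4:ℝ) = 2 ^ (2:ℝ) by norm_num, ← Real.rpow_mul (by norm_num),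
            ← Real.rpow_natCast 2 n]
          congr 1; ring
        rw [this]; field_simp
      rw [r1, r2, r3]
      have : (2⁻¹:ℝ) ^ n * 2 ^ n = 1 := by rw [← mul_pow]; norm_num
      have e : (2⁻¹:ℝ) ^ n * (4 * (t ^ (-(n/2:ℝ)) * t * (2 ^ n / 4) * b (t / 4)))
         = t ^ (-(n/2:ℝ)) * t * b (t/4) := by
        linear_combination (t ^ (-(n/2:ℝ)) * t * b (t/4)) * this
      rw [e]
      field_simp
      ring
    · have t0 : t = 0 := le_antisymm hneg (sq_nonneg _)
      rw [t0]
      simp [hm, hq, c0 0 (by norm_num), b0 0 (by norm_num)]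

theorem hcs {n : ℕ} {g : EE n → ℝ} (h : ∀ z, 3 ≤ ‖z‖ → g z = 0) : HasCompactSupport g := by
  refine HasCompactSupport.intro (isCompact_closedBall 0 3) fun z hz => h z ?_
  simp at hz; linarith

theorem pd_const_mul {n : ℕ} (k : Fin n) (c : ℝ) {g : EE n → ℝ} (hg : Differentiable ℝ g) :
    pd k (fun z => c * g z) = fun z => c * pd k g z := by
  funext z
  unfold pd
  rw [fderiv_const_mul (hg z)]
  simp

theorem pd_contDiff {n : ℕ} (k : Fin n) {g : EE n → ℝ} (hg : ContDiff ℝ ∞ g) : ContDiff ℝ ∞ (pd k g) := by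
  unfold pd
  exact (hg.fderiv_right (m := ∞) (by simp)).clm_apply contDiff_const

theorem exists_kernel (n : ℕ) (hn : 0 < n) : ∃ φ Ψ : EE n → ℝ, 
    ContDiff ℝ ∞ φ ∧ ContDiff ℝ ∞ Ψ ∧ (∀ z, 3 ≤ ‖z‖ → φ z = 0) ∧ (∀ z, 3 ≤ ‖z‖ → Ψ z = 0) ∧
    ∫ z, φ z = 1 ∧
    ∀ z, ∑ k, pd k (pd k Ψ) z = (2⁻¹ : ℝ) ^ n * φ ((2⁻¹ : ℝ) • z) - φ z := by
  obtain ⟨φ, Ψ, h1, h2, h3, h4, h5, h6, h7⟩ := exists_kernel0 n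
  obtain ⟨z0, hz0⟩ := h6 hn
  have hpos : 0 < ∫ z, φ z := 
    h1.continuous.integral_pos_of_hasCompactSupport_nonneg_nonzero (hcs h3) h5 hz0
  set c := (∫ z, φ z)⁻¹ with hc
  refine ⟨fun z => c * φ z, fun z => c * Ψ z, contDiff_const.mul h1, contDiff_const.mul h2,
    fun z hz => by simp [h3 z hz], fun z hz => by simp [h4 z hz], ?_, ?_⟩
  · rw [integral_const_mul, hc, inv_mul_cancel₀ hpos.ne']
  · intro z
    have : ∀ k : Fin n, pd k (pd k fun z => c * Ψ z) z = c * pd k (pd k Ψ) z := by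
      intro k
      rw [pd_const_mul k c (h2.differentiable (by simp)),
        pd_const_mul k c ((pd_contDiff k h2).differentiable (by simp))]
    rw [Finset.sum_congr rfl fun k _ => this k, ← Finset.mul_sum, h7]
    ring

theorem pd_hcs {n : ℕ} (k : Fin n) {g : EE n → ℝ} (hg : HasCompactSupport g) :
    HasCompactSupport (pd k g) := by
  unfold pd
  exact hg.fderiv_apply (𝕜 := ℝ) _

theorem pd_continuous {n : ℕ} (k : Fin n) {g : EE n → ℝ} (hg : ContDiff ℝ 1 g) : Continuous (pd k g) := by
  unfold pd
  exact (hg.continuous_fderiv (by simp)).clm_apply continuous_const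

theorem ibp1 {n : ℕ} (a : Fin n) {s θ : EE n → ℝ} (hs : ContDiff ℝ 1 s) (hθ : ContDiff ℝ 1 θ)
    (hc : HasCompactSupport θ) : ∫ z, s z * pd a θ z = - ∫ z, pd a s z * θ z := by
  apply integral_mul_fderiv_eq_neg_fderiv_mul_of_integrable
  · exact ((pd_continuous a hs).mul hθ.continuous).integrable_of_hasCompactSupport hc.mul_left
  · exact (hs.continuous.mul (pd_continuous a hθ)).integrable_of_hasCompactSupport
      (pd_hcs a hc).mul_left
  · exact (hs.continuous.mul hθ.continuous).integrable_of_hasCompactSupport hc.mul_left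
  · exact fun x _ => hs.differentiable (by simp) x
  · exact fun x _ => hθ.differentiable (by simp) x

theorem pd_comm {n : ℕ} (a b : Fin n) {θ : EE n → ℝ} (hθ : ContDiff ℝ ∞ θ) (z : EE n) :
    pd a (pd b θ) z = pd b (pd a θ) z := by
  have hs : IsSymmSndFDerivAt ℝ θ z := (hθ.contDiffAt).isSymmSndFDerivAt (by simp only [minSmoothness_of_isRCLikeNormedField]; exact WithTop.coe_le_coe.2 le_top)
  have hd : DifferentiableAt ℝ (fderiv ℝ θ) z :=
    (hθ.fderiv_right (m := ∞) (by simp)).differentiable (by simp) z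
  unfold pd
  rw [fderiv_clm_apply hd (by fun_prop), fderiv_clm_apply hd (by fun_prop)]
  simpa using hs.eq _ _

theorem ibp2 {n : ℕ} (a b : Fin n) {s θ : EE n → ℝ} (hs : ContDiff ℝ 1 s) (hθ : ContDiff ℝ ∞ θ)
    (hc : HasCompactSupport θ) : ∫ z, pd a s z * pd b θ z = ∫ z, pd b s z * pd a θ z := by
  have h1 := ibp1 a hs ((pd_contDiff b hθ).of_le (by simp)) (pd_hcs b hc)
  have h2 := ibp1 b hs ((pd_contDiff a hθ).of_le (by simp)) (pd_hcs a hc)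
  have h3 : ∫ z, s z * pd a (pd b θ) z = ∫ z, s z * pd b (pd a θ) z := by
    simp_rw [pd_comm a b hθ]
  linarith

theorem ibp3 {n : ℕ} (i j : Fin n) {s : Fin n → EE n → ℝ} {Ψ : EE n → ℝ} (hs : ∀ k, ContDiff ℝ 1 (s k))
    (hsym : ∀ a b z, pd a (s b) z = pd b (s a) z)
    (hΨ : ContDiff ℝ ∞ Ψ) (hc : HasCompactSupport Ψ) :
    ∫ z, pd i (s j) z * ∑ k, pd k (pd k Ψ) z = ∫ z, (∑ k, pd k (s k) z) * pd i (pd j Ψ) z := by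
  have int : ∀ a b c d : Fin n, Integrable fun z => pd a (s b) z * pd c (pd d Ψ) z := by
    intro a b c d
    exact ((pd_continuous a (hs b)).mul (pd_contDiff c (pd_contDiff d hΨ)).continuous
      ).integrable_of_hasCompactSupport (pd_hcs c (pd_hcs d hc)).mul_left
  simp_rw [Finset.mul_sum, Finset.sum_mul]
  rw [integral_finsetSum _ fun k _ => int _ _ _ _, integral_finsetSum _ fun k _ => int _ _ _ _]
  refine Finset.sum_congr rfl fun k _ => ?_
  rw [ibp2 i k (hs j) (pd_contDiff k hΨ) (pd_hcs k hc)]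
  simp_rw [hsym k j, pd_comm i k hΨ]
  rw [ibp2 j k (hs k) (pd_contDiff i hΨ) (pd_hcs i hc)]
  simp_rw [pd_comm j i hΨ]


noncomputable def Av {n : ℕ} (p φ : EE n → ℝ) (r : ℝ) (y : EE n) : ℝ := ∫ z, p (y + r • z) * φ z

theorem Av_step {n : ℕ} {φ Ψ : EE n → ℝ} (hφ : ContDiff ℝ ∞ φ) (hΨ : ContDiff ℝ ∞ Ψ)
    (hφ0 : ∀ z, 3 ≤ ‖z‖ → φ z = 0) (hΨ0 : ∀ z, 3 ≤ ‖z‖ → Ψ z = 0)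
    (hL : ∀ z, ∑ k, pd k (pd k Ψ) z = (2⁻¹ : ℝ) ^ n * φ ((2⁻¹ : ℝ) • z) - φ z)
    {s : Fin n → EE n → ℝ} (hs : ∀ k, ContDiff ℝ 1 (s k))
    (hsym : ∀ a b z, pd a (s b) z = pd b (s a) z) (i j : Fin n) (r : ℝ) (hr : 0 < r) (y : EE n) :
    Av (pd i (s j)) φ (2 * r) y - Av (pd i (s j)) φ r y
      = ∫ z, (∑ k, pd k (s k) (y + r • z)) * pd i (pd j Ψ) z := by
  set t : Fin n → EE n → ℝ := fun k z => r⁻¹ * s k (y + r • z) with ht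
  have hin : ContDiff ℝ 1 (fun z : EE n => y + r • z) := contDiff_const.add (contDiff_id.const_smul r)
  have ht1 : ∀ k, ContDiff ℝ 1 (t k) := fun k => contDiff_const.mul ((hs k).comp hin)
  have htp : ∀ a b z, pd a (t b) z = pd a (s b) (y + r • z) := by
    intro a b z
    have h1 : HasFDerivAt (fun z : EE n => y + r • z) (r • ContinuousLinearMap.id ℝ (EE n)) z :=
      ((hasFDerivAt_id z).const_smul r).const_add y
    have h2 : HasFDerivAt (s b) (fderiv ℝ (s b) (y + r • z)) (y + r • z) :=
      ((hs b).differentiable (by simp) _).hasFDerivAt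
    have h3 : HasFDerivAt (t b) _ z := (h2.comp z h1).const_mul r⁻¹
    unfold pd
    rw [h3.fderiv]
    simp
    field_simp
  have key := ibp3 i j ht1 (fun a b z => by rw [htp, htp, hsym]) hΨ (hcs hΨ0)
  simp_rw [htp, hL] at key
  rw [← key]
  have hpc : Continuous (pd i (s j)) := pd_continuous i (hs j)
  have i1 : Integrable fun z => pd i (s j) (y + (2 * r) • z) * φ z :=
    ((hpc.comp (by fun_prop)).mul hφ.continuous).integrable_of_hasCompactSupport (hcs hφ0).mul_left
  have i2 : Integrable fun z => pd i (s j) (y + r • z) * φ z :=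
    ((hpc.comp (by fun_prop)).mul hφ.continuous).integrable_of_hasCompactSupport (hcs hφ0).mul_left
  have e1 := Measure.integral_comp_smul (volume : Measure (EE n)) 
    (fun z => pd i (s j) (y + (2 * r) • z) * φ z) (2⁻¹ : ℝ)
  have i3 := i1.comp_smul (show (2⁻¹ : ℝ) ≠ 0 by norm_num)
  have e2 : ∀ z : EE n, y + (2 * r) • ((2⁻¹ : ℝ) • z) = y + r • z := by
    intro z; rw [smul_smul]; congr 2; ring
  simp_rw [e2] at e1 i3
  simp only [finrank_euclideanSpace, Fintype.card_fin] at e1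
  have e3 : ∀ z : EE n, pd i (s j) (y + r • z) * ((2⁻¹ : ℝ) ^ n * φ ((2⁻¹ : ℝ) • z) - φ z)
     = (2⁻¹ : ℝ) ^ n * (pd i (s j) (y + r • z) * φ ((2⁻¹ : ℝ) • z)) - pd i (s j) (y + r • z) * φ z := by
    intro z; ring
  simp_rw [e3]
  rw [integral_sub (i3.const_mul _) i2, integral_const_mul, e1, smul_eq_mul, abs_of_pos (by positivity),
    mul_inv_cancel_left₀ (by positivity)]
  rfl

theorem Av_bound {n : ℕ} {q θ : EE n → ℝ} (hθ : Continuous θ)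
    (hθ0 : ∀ z, 3 ≤ ‖z‖ → θ z = 0) {r Q : ℝ} {y : EE n}
    (hQ : ∀ z, ‖z‖ ≤ 3 → |q (y + r • z)| ≤ Q) :
    |∫ z, q (y + r • z) * θ z| ≤ Q * ∫ z, |θ z| := by
  rw [← integral_const_mul, ← Real.norm_eq_abs]
  refine norm_integral_le_of_norm_le ?_ ?_
  · exact ((hθ.integrable_of_hasCompactSupport (hcs hθ0)).abs).const_mul _
  · refine Eventually.of_forall fun z => ?_
    rw [Real.norm_eq_abs, abs_mul]
    rcases le_total ‖z‖ 3 with h | h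
    · exact mul_le_mul_of_nonneg_right (hQ z h) (abs_nonneg _)
    · simp [hθ0 z h]

theorem Av_diff {n : ℕ} {q θ : EE n → ℝ} (hq : Continuous q) (hθ : Continuous θ)
    (hθ0 : ∀ z, 3 ≤ ‖z‖ → θ z = 0) {L : ℝ} (hL0 : 0 ≤ L) (hL : ∀ z w, |θ z - θ w| ≤ L * ‖z - w‖)
    {r Q : ℝ} {y y' : EE n} (hr : 0 < r) (hyy : ‖y - y'‖ ≤ r)
    (hQ : ∀ z, ‖z‖ ≤ 4 → |q (y + r • z)| ≤ Q) :
    |(∫ z, q (y + r • z) * θ z) - ∫ z, q (y' + r • z) * θ z| ≤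
      Q * L * (‖y - y'‖ / r) * volume.real (Metric.closedBall (0 : EE n) 4) := by
  set e : EE n := r⁻¹ • (y - y') with he
  have hen : ‖e‖ = ‖y - y'‖ / r := by
    rw [he, norm_smul, Real.norm_eq_abs, abs_of_pos (inv_pos.2 hr)]; ring
  have he1 : ‖e‖ ≤ 1 := by rw [hen]; exact (div_le_one hr).2 hyy
  have h1 : ∫ z, q (y' + r • z) * θ z = ∫ z, q (y + r • z) * θ (z + e) := by
    rw [← integral_add_right_eq_self (fun z => q (y' + r • z) * θ z) e]
    congr 1; funext z
    have : y' + r • (z + e) = y + r • z := by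
      rw [he, smul_add, smul_smul, mul_inv_cancel₀ hr.ne', one_smul]; abel
    rw [this]
  have hθe : ∀ z, 4 ≤ ‖z‖ → θ (z + e) = 0 := fun z hz => hθ0 _ (by
    have := norm_sub_le (z + e) e
    rw [add_sub_cancel_right] at this; linarith)
  have hcs' : HasCompactSupport fun z => θ (z + e) := by
    refine HasCompactSupport.intro (isCompact_closedBall 0 4) fun z hz => hθe z ?_
    simp at hz; linarith
  have i1 : Integrable fun z => q (y + r • z) * θ z :=
    ((hq.comp (by fun_prop)).mul hθ).integrable_of_hasCompactSupport (hcs hθ0).mul_left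
  have i2 : Integrable fun z => q (y + r • z) * θ (z + e) :=
    ((hq.comp (by fun_prop)).mul (hθ.comp (by fun_prop))).integrable_of_hasCompactSupport hcs'.mul_left
  rw [h1, ← integral_sub i1 i2, ← hen, 
    ← setIntegral_eq_integral_of_forall_compl_eq_zero (s := Metric.closedBall (0 : EE n) 4)]
  · rw [← Real.norm_eq_abs]
    refine norm_setIntegral_le_of_norm_le_const ?_ ?_
    · exact (isCompact_closedBall _ _).measure_lt_top
    · intro z hz
      rw [← mul_sub, Real.norm_eq_abs, abs_mul, mul_assoc Q]
      have h2 := hL z (z + e)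
      have h3 : ‖z - (z + e)‖ = ‖e‖ := by rw [sub_add_cancel_left, norm_neg]
      rw [h3] at h2
      have h4 := hQ z (by simpa using hz)
      exact mul_le_mul h4 h2 (abs_nonneg _) ((abs_nonneg _).trans h4)
  · intro z hz
    have : 4 ≤ ‖z‖ := by simp at hz; linarith
    rw [hθe z this, hθ0 z (by linarith)]; simp

theorem Av_tendsto {n : ℕ} {p φ : EE n → ℝ} (hp : Continuous p) (hφ : Continuous φ)
    (hφ0 : ∀ z, 3 ≤ ‖z‖ → φ z = 0) (h1 : ∫ z, φ z = 1) (y : EE n) :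
    Tendsto (fun r => Av p φ r y) (nhds 0) (nhds (p y)) := by
  have hc : Continuous fun r => Av p φ r y := by
    have : (fun r => Av p φ r y) = fun r => ∫ z in Metric.closedBall (0 : EE n) 3, p (y + r • z) * φ z := by
      funext r
      unfold Av
      rw [setIntegral_eq_integral_of_forall_compl_eq_zero]
      intro z hz
      rw [hφ0 z (by simp at hz; linarith), mul_zero]
    rw [this]
    exact continuous_parametric_integral_of_continuous (f := fun (r : ℝ) (z : EE n) => p (y + r • z) * φ z) 
      (by unfold Function.uncurry; fun_prop) (isCompact_closedBall _ _)
  have := hc.tendsto 0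
  convert this using 2
  unfold Av
  simp [integral_const_mul, h1]


theorem est1 {n : ℕ} {p h φ θ : EE n → ℝ} {α : ℝ} (hα : 0 < α) (hp : Continuous p) (hφ : Continuous φ)
    (hφ0 : ∀ z, 3 ≤ ‖z‖ → φ z = 0) (h1 : ∫ z, φ z = 1) (hh : Continuous h) (hθ : Continuous θ)
    (hθ0 : ∀ z, 3 ≤ ‖z‖ → θ z = 0) (hθi : ∫ z, θ z = 0)
    (hstep : ∀ r, 0 < r → ∀ y, Av p φ (2 * r) y - Av p φ r y = Av h θ r y) :
    ∃ C : ℝ, 0 ≤ C ∧ ∀ (y : EE n) (r H : ℝ), 0 < r → 0 ≤ H →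
      (∀ z, ‖z - y‖ ≤ 3 * r → |h z - h y| ≤ H * ‖z - y‖ ^ α) → |p y - Av p φ r y| ≤ C * H * r ^ α := by
  set x : ℝ := 2⁻¹ ^ α with hx
  have hx1 : x < 1 := Real.rpow_lt_one (by norm_num) (by norm_num) hα
  have hx0 : 0 ≤ x := by positivity
  set N := ∫ z, |θ z|
  have hN : 0 ≤ N := integral_nonneg fun z => abs_nonneg _
  refine ⟨3 ^ α * N / (1 - x), div_nonneg (by positivity) (by linarith), fun y r H hr hH hHol => ?_⟩
  have hsub : ∀ r', Av h θ r' y = ∫ z, (fun w => h w - h y) (y + r' • z) * θ z := by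
    intro r'
    have i1 : Integrable fun z => h (y + r' • z) * θ z :=
      ((hh.comp (by fun_prop)).mul hθ).integrable_of_hasCompactSupport (hcs hθ0).mul_left
    have i2 : Integrable fun z => h y * θ z :=
      (hθ.integrable_of_hasCompactSupport (hcs hθ0)).const_mul _
    simp_rw [sub_mul]
    rw [integral_sub i1 i2, integral_const_mul, hθi]
    unfold Av; simp
  have hd : ∀ k : ℕ, dist (Av p φ (r * 2⁻¹ ^ k) y) (Av p φ (r * 2⁻¹ ^ (k + 1)) y) ≤
      (H * 3 ^ α * N * r ^ α) * x ^ k := by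
    intro k
    set r' := r * 2⁻¹ ^ (k + 1) with hr'
    have hr'0 : 0 < r' := by positivity
    have hr2 : r * 2⁻¹ ^ k = 2 * r' := by rw [hr', pow_succ]; ring
    have hr'r : r' ≤ r * 2⁻¹ ^ k := by rw [hr2]; linarith
    have hr'1 : r' ≤ r := hr'r.trans (by
      have : (2⁻¹ : ℝ) ^ k ≤ 1 := pow_le_one₀ (by norm_num) (by norm_num)
      nlinarith)
    rw [Real.dist_eq, hr2, hstep r' hr'0, hsub]
    have hb := Av_bound (q := fun w => h w - h y) (θ := θ) hθ hθ0 (r := r') (Q := H * (3 * r') ^ α) (y := y) (by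
      intro z hz
      have e : ‖y + r' • z - y‖ ≤ 3 * r' := by
        rw [add_sub_cancel_left, norm_smul, Real.norm_eq_abs, abs_of_pos hr'0]; nlinarith
      refine (hHol (y + r' • z) (e.trans (by linarith))).trans ?_
      exact mul_le_mul_of_nonneg_left (Real.rpow_le_rpow (norm_nonneg _) e hα.le) hH)
    refine hb.trans ?_
    have e1 : (3 * r') ^ α ≤ 3 ^ α * (r ^ α * x ^ k) := by
      rw [Real.mul_rpow (by norm_num) hr'0.le]
      refine mul_le_mul_of_nonneg_left ?_ (by positivity)
      refine (Real.rpow_le_rpow hr'0.le hr'r hα.le).trans (le_of_eq ?_)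
      rw [Real.mul_rpow hr.le (by positivity), hx, ← Real.rpow_natCast, ← Real.rpow_natCast,
        ← Real.rpow_mul (by norm_num), ← Real.rpow_mul (by norm_num), mul_comm (k : ℝ)]
    calc H * (3 * r') ^ α * N ≤ H * (3 ^ α * (r ^ α * x ^ k)) * N := by gcongr
      _ = _ := by ring
  have ht : Tendsto (fun k : ℕ => Av p φ (r * 2⁻¹ ^ k) y) atTop (nhds (p y)) := by
    refine (Av_tendsto hp hφ hφ0 h1 y).comp ?_
    have := (tendsto_pow_atTop_nhds_zero_of_lt_one (show (0:ℝ) ≤ 2⁻¹ by norm_num) (by norm_num)).const_mul r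
    simpa using this
  have := dist_le_of_le_geometric_of_tendsto₀ x _ hx1 hd ht
  rw [dist_comm, Real.dist_eq] at this
  simp only [pow_zero, mul_one] at this
  refine this.trans (le_of_eq ?_)
  ring

theorem Av_diff_tendsto {n : ℕ} {p φ : EE n → ℝ} {K : ℝ} (hp : Continuous p) (hpK : ∀ y, |p y| ≤ K)
    (hφ : Continuous φ) (hφ0 : ∀ z, 3 ≤ ‖z‖ → φ z = 0)
    {L : ℝ} (hL0 : 0 ≤ L) (hL : ∀ z w, |φ z - φ w| ≤ L * ‖z - w‖) (r : ℝ) (hr : 0 < r) (y y' : EE n) :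
    Tendsto (fun k : ℕ => Av p φ (r * 2 ^ k) y - Av p φ (r * 2 ^ k) y') atTop (nhds 0) := by
  have h2 : Tendsto (fun k : ℕ => r * (2:ℝ) ^ k) atTop atTop :=
    (tendsto_pow_atTop_atTop_of_one_lt (by norm_num)).const_mul_atTop hr
  have h3 : Tendsto (fun k : ℕ => K * L * (‖y - y'‖ / (r * 2 ^ k)) * 
      volume.real (Metric.closedBall (0 : EE n) 4)) atTop (nhds 0) := by
    have := ((h2.const_div_atTop ‖y - y'‖).const_mul (K * L)).mul_const 
      (volume.real (Metric.closedBall (0 : EE n) 4))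
    simpa using this
  refine squeeze_zero_norm' ?_ h3
  filter_upwards [h2.eventually_ge_atTop ‖y - y'‖] with k hk
  exact Av_diff hp hφ hφ0 hL0 hL (by positivity) hk fun z _ => hpK _

theorem est2 {n : ℕ} {p h φ θ : EE n → ℝ} {α K : ℝ} (hα : 0 < α) (hα1 : α < 1) (hp : Continuous p)
    (hpK : ∀ y, |p y| ≤ K) (hφ : Continuous φ)
    (hφ0 : ∀ z, 3 ≤ ‖z‖ → φ z = 0) (hh : Continuous h) (hθ : Continuous θ)
    (hθ0 : ∀ z, 3 ≤ ‖z‖ → θ z = 0) (hθi : ∫ z, θ z = 0)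
    {L : ℝ} (hL0 : 0 ≤ L) (hL : ∀ z w, |φ z - φ w| ≤ L * ‖z - w‖)
    (hL' : ∀ z w, |θ z - θ w| ≤ L * ‖z - w‖)
    (hstep : ∀ r, 0 < r → ∀ y, Av p φ (2 * r) y - Av p φ r y = Av h θ r y)
    {H : ℝ} (hH : 0 ≤ H) (hHol : ∀ y z, |h z - h y| ≤ H * ‖z - y‖ ^ α) :
    ∃ C : ℝ, 0 ≤ C ∧ ∀ (y y' : EE n) (r : ℝ), 0 < r → ‖y - y'‖ ≤ r →
      |Av p φ r y - Av p φ r y'| ≤ C * r ^ α := by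
  set x : ℝ := 2 ^ (α - 1) with hx
  have hx1 : x < 1 := Real.rpow_lt_one_of_one_lt_of_neg (by norm_num) (by linarith)
  have hx0 : 0 ≤ x := by positivity
  set V := volume.real (Metric.closedBall (0 : EE n) 4) with hV
  have hV0 : 0 ≤ V := measureReal_nonneg
  refine ⟨H * 4 ^ α * L * V / (1 - x), div_nonneg (by positivity) (by linarith), fun y y' r hr hyy => ?_⟩
  have hsub : ∀ r' y'', Av h θ r' y'' = ∫ z, (fun w => h w - h y) (y'' + r' • z) * θ z := by
    intro r' y''
    have i1 : Integrable fun z => h (y'' + r' • z) * θ z :=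
      ((hh.comp (by fun_prop)).mul hθ).integrable_of_hasCompactSupport (hcs hθ0).mul_left
    have i2 : Integrable fun z => h y * θ z :=
      (hθ.integrable_of_hasCompactSupport (hcs hθ0)).const_mul _
    simp_rw [sub_mul]
    rw [integral_sub i1 i2, integral_const_mul, hθi]
    unfold Av; simp
  have hd : ∀ k : ℕ, dist (Av p φ (r * 2 ^ k) y - Av p φ (r * 2 ^ k) y')
      (Av p φ (r * 2 ^ (k+1)) y - Av p φ (r * 2 ^ (k+1)) y') ≤
      (H * 4 ^ α * L * V * r ^ α) * x ^ k := by
    intro k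
    set r' := r * 2 ^ k with hr'
    have hr'0 : 0 < r' := by positivity
    have hr2 : r * 2 ^ (k+1) = 2 * r' := by rw [hr', pow_succ]; ring
    have hrr' : r ≤ r' := by
      have : (1:ℝ) ≤ 2 ^ k := one_le_pow₀ (by norm_num)
      nlinarith
    have e0 : Av p φ r' y - Av p φ r' y' - (Av p φ (2 * r') y - Av p φ (2 * r') y')
       = -(Av h θ r' y - Av h θ r' y') := by
      rw [← hstep r' hr'0, ← hstep r' hr'0]; ring
    rw [Real.dist_eq, hr2, e0, abs_neg, hsub, hsub]
    have hb := Av_diff (q := fun w => h w - h y) (θ := θ) (hh.sub continuous_const) hθ hθ0 hL0 hL'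
      (r := r') (Q := H * (4 * r') ^ α) (y := y) (y' := y') hr'0 (hyy.trans hrr') (by
      intro z hz
      have e : ‖y + r' • z - y‖ ≤ 4 * r' := by
        rw [add_sub_cancel_left, norm_smul, Real.norm_eq_abs, abs_of_pos hr'0]; nlinarith
      refine (hHol y (y + r' • z)).trans ?_
      exact mul_le_mul_of_nonneg_left (Real.rpow_le_rpow (norm_nonneg _) e hα.le) hH)
    refine hb.trans ?_
    have e1 : ‖y - y'‖ / r' ≤ (2 ^ k)⁻¹ := by
      rw [div_le_iff₀ hr'0, hr']
      have : ((2:ℝ) ^ k)⁻¹ * (r * 2 ^ k) = r := by field_simp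
      rw [this]; exact hyy
    have e2 : (4 * r') ^ α = 4 ^ α * r ^ α * (2 ^ k) ^ α := by
      rw [Real.mul_rpow (by norm_num) hr'0.le, hr', Real.mul_rpow hr.le (by positivity)]; ring
    have e3 : ((2:ℝ) ^ k) ^ α * (2 ^ k)⁻¹ = x ^ k := by
      rw [hx, ← Real.rpow_natCast, ← Real.rpow_natCast, ← Real.rpow_mul (by norm_num),
        ← Real.rpow_mul (by norm_num), ← Real.rpow_neg (by norm_num), ← Real.rpow_add (by norm_num)]
      congr 1; ring
    calc H * (4 * r') ^ α * L * (‖y - y'‖ / r') * V ≤ H * (4 * r') ^ α * L * (2 ^ k)⁻¹ * V := by gcongr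
      _ = (H * 4 ^ α * L * V * r ^ α) * ((2 ^ k) ^ α * (2 ^ k)⁻¹) := by rw [e2]; ring
      _ = _ := by rw [e3]
  have ht := Av_diff_tendsto hp hpK hφ hφ0 hL0 hL r hr y y'
  have := dist_le_of_le_geometric_of_tendsto₀ x _ hx1 hd ht
  rw [Real.dist_eq] at this
  simp only [pow_zero, mul_one, sub_zero] at this
  refine this.trans (le_of_eq ?_)
  ring

theorem est3 {n : ℕ} (hn : 0 < n) {p h φ θ : EE n → ℝ} {K : ℝ} (hp : Continuous p)
    (hpK : ∀ y, |p y| ≤ K) (hφ : Continuous φ)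
    (hφ0 : ∀ z, 3 ≤ ‖z‖ → φ z = 0) (hh : Continuous h) (hθ : Continuous θ)
    (hθ0 : ∀ z, 3 ≤ ‖z‖ → θ z = 0) (hθi : ∫ z, θ z = 0)
    {L : ℝ} (hL0 : 0 ≤ L) (hL : ∀ z w, |φ z - φ w| ≤ L * ‖z - w‖)
    (hstep : ∀ r, 0 < r → ∀ y, Av p φ (2 * r) y - Av p φ r y = Av h θ r y)
    {hinf D E ζ ε : ℝ} (hζ : 0 < ζ) (hε : 0 < ε) (hε1 : ε ≤ ζ / 2) (hε2 : ε ≤ 1 / 2)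
    (hD0 : 0 ≤ D) (hE0 : 0 ≤ E) (hD : ∀ y, |h y - hinf| ≤ D)
    (hE : ∀ y, 0 < ‖y‖ → |h y - hinf| ≤ E * ‖y‖ ^ (-ζ)) :
    ∃ B C : ℝ, 0 ≤ C ∧ ∀ (k : ℕ) (y : EE n), |Av p φ (2 ^ k) y - B| ≤ C * ((2:ℝ) ^ k) ^ (-ε) := by
  set x : ℝ := 2 ^ (-ε) with hx
  have hx1 : x < 1 := Real.rpow_lt_one_of_one_lt_of_neg (by norm_num) (by linarith)
  have hx0 : 0 ≤ x := by positivity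
  have hxk : ∀ k : ℕ, ((2:ℝ) ^ k) ^ (-ε) = x ^ k := by
    intro k
    rw [hx, ← Real.rpow_natCast, ← Real.rpow_natCast, ← Real.rpow_mul (by norm_num),
      ← Real.rpow_mul (by norm_num), mul_comm]
  set V := volume.real (Metric.closedBall (0 : EE n) 1) with hV
  have hV0 : 0 ≤ V := measureReal_nonneg
  set N := ∫ z, |θ z|
  have hN : 0 ≤ N := integral_nonneg fun z => abs_nonneg _
  obtain ⟨Θ, hΘ⟩ : ∃ Θ, ∀ z, |θ z| ≤ Θ := by
    obtain ⟨Θ, h⟩ := hθ.bounded_above_of_compact_support (hcs hθ0)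
    exact ⟨Θ, h⟩
  have hΘ0 : 0 ≤ Θ := (abs_nonneg _).trans (hΘ 0)
  have hsub : ∀ r' y'', Av h θ r' y'' = ∫ z, (h (y'' + r' • z) - hinf) * θ z := by
    intro r' y''
    have i1 : Integrable fun z => h (y'' + r' • z) * θ z :=
      ((hh.comp (by fun_prop)).mul hθ).integrable_of_hasCompactSupport (hcs hθ0).mul_left
    have i2 : Integrable fun z => hinf * θ z :=
      (hθ.integrable_of_hasCompactSupport (hcs hθ0)).const_mul _
    simp_rw [sub_mul]
    rw [integral_sub i1 i2, integral_const_mul, hθi]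
    unfold Av; simp
  have hd : ∀ (y : EE n) (k : ℕ), dist (Av p φ (2 ^ k) y) (Av p φ (2 ^ (k+1)) y) ≤
      (D * Θ * V + E * N) * x ^ k := by
    intro y k
    set r : ℝ := 2 ^ k with hr
    have hr1 : 1 ≤ r := one_le_pow₀ (by norm_num)
    have hr0 : 0 < r := by linarith
    rw [Real.dist_eq, pow_succ, mul_comm _ (2:ℝ), ← hr, abs_sub_comm, hstep r hr0, hsub]
    set T := Metric.closedBall (-(r⁻¹ • y)) (r ^ (-(1/2):ℝ)) with hT
    have hTv : volume.real T = (r ^ (-(1/2):ℝ)) ^ n * V := by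
      rw [hT, measureReal_def, Measure.addHaar_closedBall' _ _ (by positivity), ENNReal.toReal_mul, 
        ENNReal.toReal_ofReal (by positivity), hV, measureReal_def]
      simp
    have hTm : MeasurableSet T := measurableSet_closedBall
    have hTfin : volume T < ⊤ := (isCompact_closedBall _ _).measure_lt_top
    have hpt : ∀ z, ‖(h (y + r • z) - hinf) * θ z‖ ≤ T.indicator (fun _ => D * Θ) z + (E * r ^ (-ε)) * |θ z| := by
      intro z
      rw [Real.norm_eq_abs, abs_mul]
      by_cases hz : z ∈ T
      · rw [Set.indicator_of_mem hz]
        have := mul_le_mul (hD (y + r • z)) (hΘ z) (abs_nonneg _) hD0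
        have h2 : 0 ≤ (E * r ^ (-ε)) * |θ z| := by positivity
        linarith
      · rw [Set.indicator_of_notMem hz, zero_add]
        refine mul_le_mul_of_nonneg_right ?_ (abs_nonneg _)
        have hz' : r ^ (-(1/2):ℝ) < ‖z + r⁻¹ • y‖ := by
          simpa [hT, dist_eq_norm] using hz
        have e1 : y + r • z = r • (z + r⁻¹ • y) := by
          rw [smul_add, smul_smul, mul_inv_cancel₀ hr0.ne', one_smul, add_comm]
        have e2 : r ^ (1/2:ℝ) ≤ ‖y + r • z‖ := by
          rw [e1, norm_smul, Real.norm_eq_abs, abs_of_pos hr0]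
          have : r ^ (1/2:ℝ) = r * r ^ (-(1/2):ℝ) := by
            nth_rewrite 2 [← Real.rpow_one r]
            rw [← Real.rpow_add hr0]; norm_num
          rw [this]
          exact mul_le_mul_of_nonneg_left hz'.le hr0.le
        have e3 : 0 < r ^ (1/2:ℝ) := by positivity
        refine (hE _ (e3.trans_le e2)).trans (mul_le_mul_of_nonneg_left ?_ hE0)
        calc ‖y + r • z‖ ^ (-ζ) ≤ (r ^ (1/2:ℝ)) ^ (-ζ) :=
              Real.rpow_le_rpow_of_nonpos e3 e2 (by linarith)
          _ = r ^ (-(ζ/2)) := by rw [← Real.rpow_mul hr0.le]; congr 1; ring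
          _ ≤ r ^ (-ε) := Real.rpow_le_rpow_of_exponent_le hr1 (by linarith)
    have iθ : Integrable fun z => |θ z| := (hθ.integrable_of_hasCompactSupport (hcs hθ0)).abs
    have i1 : Integrable (T.indicator (fun _ : EE n => D * Θ)) := 
      (integrable_indicator_iff hTm).2 (integrableOn_const hTfin.ne)
    have := norm_integral_le_of_norm_le (i1.add (iθ.const_mul (E * r ^ (-ε)))) (Eventually.of_forall hpt)
    rw [← Real.norm_eq_abs]
    refine this.trans ?_
    simp only [Pi.add_apply]
    rw [integral_add i1 (iθ.const_mul _), integral_const_mul, integral_indicator hTm, setIntegral_const,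
      hTv, ← hxk]
    have e5 : (r ^ (-(1/2):ℝ)) ^ n ≤ r ^ (-ε) := by
      rw [← Real.rpow_natCast, ← Real.rpow_mul hr0.le]
      refine Real.rpow_le_rpow_of_exponent_le hr1 ?_
      have : (1:ℝ) ≤ n := by exact_mod_cast hn
      linarith
    have e6 : (r ^ (-(1/2):ℝ)) ^ n * V * (D * Θ) ≤ r ^ (-ε) * V * (D * Θ) := by gcongr
    rw [smul_eq_mul]
    calc _ ≤ r ^ (-ε) * V * (D * Θ) + E * r ^ (-ε) * N := by linarith
      _ = _ := by ring
  have hlim : ∀ y, ∃ B, Tendsto (fun k : ℕ => Av p φ (2 ^ k) y) atTop (nhds B) := fun y =>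
    cauchySeq_tendsto_of_complete (cauchySeq_of_le_geometric x _ hx1 (hd y))
  obtain ⟨B, hB⟩ := hlim 0
  have hB' : ∀ y, Tendsto (fun k : ℕ => Av p φ (2 ^ k) y) atTop (nhds B) := by
    intro y
    have h1 := Av_diff_tendsto hp hpK hφ hφ0 hL0 hL 1 one_pos y 0
    have := h1.add hB
    simpa using this
  refine ⟨B, (D * Θ * V + E * N) / (1 - x), div_nonneg (by positivity) (by linarith), fun k y => ?_⟩
  have := dist_le_of_le_geometric_of_tendsto x _ hx1 (hd y) (hB' y) k
  rw [Real.dist_eq] at this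
  rw [hxk]
  refine this.trans (le_of_eq ?_)
  ring


theorem lip_of_smooth {n : ℕ} {g : EE n → ℝ} (hg : ContDiff ℝ ∞ g) (hc : HasCompactSupport g) :
    ∃ L : ℝ, 0 ≤ L ∧ ∀ z w, |g z - g w| ≤ L * ‖z - w‖ := by
  obtain ⟨C, hC⟩ := hg.lipschitzWith_of_hasCompactSupport hc (by simp)
  refine ⟨C, C.2, fun z w => ?_⟩
  have := hC.dist_le_mul z w
  rwa [Real.dist_eq, dist_eq_norm] at this

theorem pd_zero_of {n : ℕ} (k : Fin n) {g : EE n → ℝ} (hg : ContDiff ℝ ∞ g) (h : ∀ z, 3 ≤ ‖z‖ → g z = 0) :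
    ∀ z, 3 ≤ ‖z‖ → pd k g z = 0 := by
  intro z hz
  -- the derivative vanishes on the open exterior, hence on its closure by continuity
  have h1 : ∀ w : EE n, 3 < ‖w‖ → pd k g w = 0 := by
    intro w hw
    have : g =ᶠ[nhds w] fun _ => 0 := by
      filter_upwards [(isOpen_lt continuous_const continuous_norm).mem_nhds hw] with v hv
      exact h v (le_of_lt hv)
    unfold pd
    rw [this.fderiv_eq]; simp
  have hc : Continuous (pd k g) := (pd_contDiff k hg).continuous
  have ht : Tendsto (fun t : ℝ => pd k g (t • z)) (nhdsWithin 1 (Set.Ioi 1)) (nhds (pd k g ((1:ℝ) • z))) :=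
    ((hc.comp (by fun_prop : Continuous fun t : ℝ => t • z)).tendsto 1).mono_left nhdsWithin_le_nhds
  rw [one_smul] at ht
  refine tendsto_nhds_unique ht (tendsto_const_nhds.congr' ?_)
  filter_upwards [self_mem_nhdsWithin] with t ht
  have ht' : (1:ℝ) < t := ht
  symm
  apply h1
  rw [norm_smul, Real.norm_eq_abs, abs_of_pos (by linarith)]
  nlinarith

theorem integral_pd_zero {n : ℕ} (k : Fin n) {g : EE n → ℝ} (hg : ContDiff ℝ ∞ g) (hc : HasCompactSupport g) :
    ∫ z, pd k g z = 0 := by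
  have := ibp1 k (s := fun _ => 1) contDiff_const (hg.of_le (by simp)) hc
  simpa [pd] using this

theorem potential_ij {n : ℕ} (hn : 0 < n) {α ζ ζ' : ℝ} (hα : 0 < α) (hα1 : α < 1) (hζ : 0 < ζ) (hζ' : 0 < ζ')
    {s : Fin n → EE n → ℝ} (hs : ∀ k, ContDiff ℝ 1 (s k))
    (hsym : ∀ a b z, pd a (s b) z = pd b (s a) z) {K : ℝ} (hK : ∀ a b z, |pd a (s b) z| ≤ K)
    {h : EE n → ℝ} (hh : ∀ z, h z = ∑ k, pd k (s k) z) {H : ℝ} (hH : 0 ≤ H)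
    (hHol : ∀ y z, |h z - h y| ≤ H * ‖z - y‖ ^ α) {hinf R δ Cd : ℝ} (hR : 1 ≤ R) (hδ : 0 < δ) (hCd : 0 ≤ Cd)
    (hdec : ∀ y, R ≤ ‖y‖ → |h y - hinf| ≤ Cd * ‖y‖ ^ (-ζ))
    (hdecH : ∀ y, R ≤ ‖y‖ → ∀ z, ‖z - y‖ ≤ δ * ‖y‖ → |h z - h y| ≤ Cd * ‖y‖ ^ (-(α + ζ')) * ‖z - y‖ ^ α)
    (i j : Fin n) :
    ∃ B C : ℝ, (∀ y y', |pd i (s j) y - pd i (s j) y'| ≤ C * ‖y - y'‖ ^ α) ∧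
      ∀ y, max R (3 / δ) ≤ ‖y‖ → |pd i (s j) y - B| ≤ C * ‖y‖ ^ (-(min (min (ζ / 2) (1 / 2)) ζ')) := by
  obtain ⟨φ, Ψ, hφ, hΨ, hφ0, hΨ0, hφ1, hL⟩ := exists_kernel n hn
  set θ := pd i (pd j Ψ) with hθdef
  set p := pd i (s j) with hpdef
  set ε := min (min (ζ / 2) (1 / 2)) ζ' with hε
  have hε0 : 0 < ε := by
    rw [hε]; exact lt_min (lt_min (by linarith) (by norm_num)) hζ'
  have hθs : ContDiff ℝ ∞ θ := pd_contDiff i (pd_contDiff j hΨ)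
  have hθ0 : ∀ z, 3 ≤ ‖z‖ → θ z = 0 := pd_zero_of i (pd_contDiff j hΨ) (pd_zero_of j hΨ hΨ0)
  have hθi : ∫ z, θ z = 0 := integral_pd_zero i (pd_contDiff j hΨ) (pd_hcs j (hcs hΨ0))
  obtain ⟨L1, hL10, hL1⟩ := lip_of_smooth hφ (hcs hφ0)
  obtain ⟨L2, hL20, hL2⟩ := lip_of_smooth hθs (hcs hθ0)
  have hp : Continuous p := pd_continuous i (hs j)
  have hhc : Continuous h := by
    rw [funext hh]; exact continuous_finset_sum _ fun k _ => pd_continuous k (hs k)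
  have hstep : ∀ r, 0 < r → ∀ y, Av p φ (2 * r) y - Av p φ r y = Av h θ r y := by
    intro r hr y
    rw [Av_step hφ hΨ hφ0 hΨ0 hL hs hsym i j r hr y]
    unfold Av
    simp_rw [hh, hθdef]
  have hK0 : 0 ≤ K := (abs_nonneg _).trans (hK i j 0)
  have hD : ∀ y, |h y - hinf| ≤ n * K + |hinf| := by
    intro y
    refine (abs_sub _ _).trans ?_
    gcongr
    rw [hh]
    refine (Finset.abs_sum_le_sum_abs _ _).trans ((Finset.sum_le_sum fun k _ => hK k k y).trans ?_)
    simp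
  set D := n * K + |hinf|
  have hD0 : 0 ≤ D := by positivity
  have hE : ∀ y, 0 < ‖y‖ → |h y - hinf| ≤ (Cd + D * R ^ ζ) * ‖y‖ ^ (-ζ) := by
    intro y hy
    have hpos : 0 < ‖y‖ ^ (-ζ) := by positivity
    have hR0 : 0 < R := by linarith
    rcases le_total R ‖y‖ with hRy | hRy
    · refine (hdec y hRy).trans (mul_le_mul_of_nonneg_right ?_ hpos.le)
      have : 0 ≤ D * R ^ ζ := by positivity
      linarith
    · refine (hD y).trans ?_
      have h1 : 1 ≤ R ^ ζ * ‖y‖ ^ (-ζ) := by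
        rw [Real.rpow_neg hy.le, ← div_eq_mul_inv, one_le_div (by positivity)]
        exact Real.rpow_le_rpow hy.le hRy hζ.le
      have : 0 ≤ Cd * ‖y‖ ^ (-ζ) := by positivity
      nlinarith
  have hE0 : 0 ≤ Cd + D * R ^ ζ := by
    have : 0 < R := by linarith
    positivity
  obtain ⟨C1, hC10, h1⟩ := est1 hα hp hφ.continuous hφ0 hφ1 hhc hθs.continuous hθ0 hθi hstep
  have hmax1 : ∀ z w, |φ z - φ w| ≤ max L1 L2 * ‖z - w‖ := fun z w => (hL1 z w).trans (by gcongr; exact le_max_left _ _)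
  have hmax2 : ∀ z w, |θ z - θ w| ≤ max L1 L2 * ‖z - w‖ := fun z w => (hL2 z w).trans (by gcongr; exact le_max_right _ _)
  have hpK : ∀ y, |p y| ≤ K := fun y => hK i j y
  obtain ⟨C2, hC20, h2⟩ := est2 hα hα1 hp hpK hφ.continuous hφ0 hhc hθs.continuous hθ0 hθi
    (hL10.trans (le_max_left _ _)) hmax1 hmax2 hstep hH hHol
  obtain ⟨B, C3, hC30, h3⟩ := est3 hn hp hpK hφ.continuous hφ0 hhc hθs.continuous hθ0 hθi hL10 hL1 hstep
    hζ hε0 ((min_le_left _ _).trans (min_le_left _ _)) ((min_le_left _ _).trans (min_le_right _ _))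
    hD0 hE0 hD hE
  set δ' := δ / 3 with hδ'
  have hδ'0 : 0 < δ' := by positivity
  refine ⟨B, max (2 * (C1 * H) + C2) (C1 * Cd * δ' ^ α + C3 * (δ' / 2) ^ (-ε)), ?_, ?_⟩
  · intro y y'
    refine le_trans ?_ (mul_le_mul_of_nonneg_right (le_max_left _ _) (by positivity))
    rcases eq_or_ne y y' with rfl | hne
    · simp [Real.zero_rpow hα.ne']
    · have hr : 0 < ‖y - y'‖ := norm_pos_iff.2 (sub_ne_zero.2 hne)
      have a1 := h1 y _ H hr hH fun z _ => hHol y z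
      have a2 := h1 y' _ H hr hH fun z _ => hHol y' z
      have a3 := h2 y y' _ hr le_rfl
      rw [abs_le] at *
      constructor <;> linarith [a1.1, a1.2, a2.1, a2.2, a3.1, a3.2]
  · intro y hy
    have hyR : R ≤ ‖y‖ := (le_max_left _ _).trans hy
    have hyδ : 3 / δ ≤ ‖y‖ := (le_max_right _ _).trans hy
    have hy0 : 0 < ‖y‖ := by linarith
    have hy1 : 1 ≤ ‖y‖ := by linarith
    refine le_trans ?_ (mul_le_mul_of_nonneg_right (le_max_right _ _) (by positivity))
    have hx : 1 ≤ δ' * ‖y‖ := by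
      rw [div_le_iff₀ hδ] at hyδ; rw [hδ']; linarith
    obtain ⟨k, hk1, hk2⟩ := exists_nat_pow_near hx (show (1:ℝ) < 2 by norm_num)
    have hr : (0:ℝ) < 2 ^ k := by positivity
    have a1 := h1 y (2 ^ k) (Cd * ‖y‖ ^ (-(α + ζ'))) hr (by positivity) (fun z hz =>
      hdecH y hyR z (hz.trans (by rw [hδ'] at hk1; linarith)))
    have a3 := h3 k y
    have b1 : ((2:ℝ) ^ k) ^ α ≤ δ' ^ α * ‖y‖ ^ α := by
      rw [← Real.mul_rpow hδ'0.le hy0.le]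
      exact Real.rpow_le_rpow hr.le hk1 hα.le
    have b2 : ‖y‖ ^ (-(α + ζ')) * ‖y‖ ^ α ≤ ‖y‖ ^ (-ε) := by
      rw [← Real.rpow_add hy0]
      refine Real.rpow_le_rpow_of_exponent_le hy1 ?_
      have : ε ≤ ζ' := min_le_right _ _
      linarith
    have b3 : ((2:ℝ) ^ k) ^ (-ε) ≤ (δ' / 2) ^ (-ε) * ‖y‖ ^ (-ε) := by
      rw [← Real.mul_rpow (by positivity) hy0.le]
      refine Real.rpow_le_rpow_of_nonpos (by positivity) ?_ (by linarith)
      rw [pow_succ] at hk2; linarith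
    have c1 : C1 * (Cd * ‖y‖ ^ (-(α + ζ'))) * (2 ^ k) ^ α ≤ C1 * Cd * δ' ^ α * ‖y‖ ^ (-ε) :=
      calc _ ≤ C1 * (Cd * ‖y‖ ^ (-(α + ζ'))) * (δ' ^ α * ‖y‖ ^ α) := by gcongr
        _ = C1 * Cd * δ' ^ α * (‖y‖ ^ (-(α + ζ')) * ‖y‖ ^ α) := by ring
        _ ≤ _ := by gcongr
    have c2 : C3 * ((2:ℝ) ^ k) ^ (-ε) ≤ C3 * (δ' / 2) ^ (-ε) * ‖y‖ ^ (-ε) := by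
      rw [mul_assoc]; gcongr
    have := abs_sub_le (p y) (Av p φ (2 ^ k) y) B
    linarith

theorem fin_bound {n : ℕ} (f : Fin n → Fin n → ℝ) : ∃ M, 0 ≤ M ∧ ∀ i j, f i j ≤ M := by
  refine ⟨∑ i, ∑ j, |f i j|, by positivity, fun i j => (le_abs_self _).trans ?_⟩
  refine le_trans ?_ (Finset.single_le_sum (f := fun i => ∑ j, |f i j|) (fun i _ => by positivity) (Finset.mem_univ i))
  exact Finset.single_le_sum (f := fun j => |f i j|) (fun i _ => by positivity) (Finset.mem_univ j)

theorem potential {n : ℕ} (hn : 0 < n) {α ζ ζ' : ℝ} (hα : 0 < α) (hα1 : α < 1) (hζ : 0 < ζ) (hζ' : 0 < ζ')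
    {s : Fin n → EE n → ℝ} (hs : ∀ k, ContDiff ℝ 1 (s k))
    (hsym : ∀ a b z, pd a (s b) z = pd b (s a) z) {K : ℝ} (hK : ∀ a b z, |pd a (s b) z| ≤ K)
    {h : EE n → ℝ} (hh : ∀ z, h z = ∑ k, pd k (s k) z) {H : ℝ} (hH : 0 ≤ H)
    (hHol : ∀ y z, |h z - h y| ≤ H * ‖z - y‖ ^ α) {hinf R δ Cd : ℝ} (hR : 1 ≤ R) (hδ : 0 < δ) (hCd : 0 ≤ Cd)
    (hdec : ∀ y, R ≤ ‖y‖ → |h y - hinf| ≤ Cd * ‖y‖ ^ (-ζ))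
    (hdecH : ∀ y, R ≤ ‖y‖ → ∀ z, ‖z - y‖ ≤ δ * ‖y‖ → |h z - h y| ≤ Cd * ‖y‖ ^ (-(α + ζ')) * ‖z - y‖ ^ α) :
    ∃ (B : Matrix (Fin n) (Fin n) ℝ) (C ε R' : ℝ), 0 < ε ∧ ε < 1 ∧ 0 ≤ C ∧ 1 ≤ R' ∧
      (∀ i j y y', |pd i (s j) y - pd i (s j) y'| ≤ C * ‖y - y'‖ ^ α) ∧
      ∀ i j y, R' ≤ ‖y‖ → |pd i (s j) y - B i j| ≤ C * ‖y‖ ^ (-ε) := by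
  have := fun i j => potential_ij hn hα hα1 hζ hζ' hs hsym hK hh hH hHol hR hδ hCd hdec hdecH i j
  choose B C h1 h2 using this
  obtain ⟨M, hM0, hM⟩ := fin_bound C
  refine ⟨B, M, min (min (ζ / 2) (1 / 2)) ζ', max R (3 / δ), lt_min (lt_min (by linarith) (by norm_num)) hζ', 
    ?_, hM0, hR.trans (le_max_left _ _), ?_, ?_⟩
  · refine ((min_le_left _ _).trans (min_le_right _ _)).trans_lt (by norm_num)
  · exact fun i j y y' => (h1 i j y y').trans (mul_le_mul_of_nonneg_right (hM i j) (by positivity))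
  · exact fun i j y hy => (h2 i j y hy).trans (mul_le_mul_of_nonneg_right (hM i j) (by positivity))


theorem sum_eig_eq_trace {n : ℕ} {A : Matrix (Fin n) (Fin n) ℝ} (hA : A.IsHermitian) (hp : (A + 1).PosDef) :
    ∑ i, 1 / (1 + hA.eigenvalues i) = (A + 1)⁻¹.trace := by
  have hpos : ∀ i, 1 + hA.eigenvalues i ≠ 0 := by
    intro i h0
    have h1 := hA.mulVec_eigenvectorBasis i
    have hne : (hA.eigenvectorBasis i).ofLp ≠ 0 := by
      intro h
      have := hA.eigenvectorBasis.orthonormal.ne_zero i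
      exact this (by ext k; simpa using congrFun h k)
    have h2 := hp.dotProduct_mulVec_pos hne
    rw [Matrix.add_mulVec, h1, Matrix.one_mulVec] at h2
    have : hA.eigenvalues i • (hA.eigenvectorBasis i).ofLp + (hA.eigenvectorBasis i).ofLp = 0 := by
      have : hA.eigenvalues i = -1 := by linarith
      rw [this]; simp
    rw [this] at h2
    simp at h2
  set Φ := Unitary.conjStarAlgAut ℝ (Matrix (Fin n) (Fin n) ℝ) hA.eigenvectorUnitary
  have hs : A = Φ (Matrix.diagonal hA.eigenvalues) := hA.spectral_theorem
  have h1 : (A + 1) * Φ (Matrix.diagonal fun i => 1 / (1 + hA.eigenvalues i)) = 1 := by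
    have : A + 1 = Φ (Matrix.diagonal fun i => 1 + hA.eigenvalues i) := by
      nth_rewrite 1 [hs]
      rw [← map_one Φ, ← map_add, ← Matrix.diagonal_one, Matrix.diagonal_add]
      congr 2
      funext i; ring
    rw [this, ← map_mul, Matrix.diagonal_mul_diagonal, ← map_one Φ, ← Matrix.diagonal_one]
    congr 2
    funext i
    exact mul_one_div_cancel (hpos i)
  rw [Matrix.inv_eq_right_inv h1, Unitary.conjStarAlgAut_apply, Matrix.trace_mul_comm, ← mul_assoc]
  simp [Matrix.trace]

theorem psd_entry_le {n : ℕ} {Q : Matrix (Fin n) (Fin n) ℝ} (hQ : Q.PosSemidef) (i j : Fin n) :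
    |Q i j| ≤ Q.trace := by
  have hd : ∀ k, 0 ≤ Q k k := fun k => hQ.diag_nonneg
  have hle : ∀ k, Q k k ≤ Q.trace := fun k =>
    Finset.single_le_sum (f := fun k => Q k k) (fun k _ => hd k) (Finset.mem_univ k)
  have hs : Q j i = Q i j := by simpa using hQ.isHermitian.apply i j
  have key : ∀ c : ℝ, 0 ≤ Q i i + 2 * c * Q i j + c ^ 2 * Q j j := by
    intro c
    have := hQ.dotProduct_mulVec_nonneg (Pi.single i 1 + c • Pi.single j 1)
    simp [Matrix.mulVec_add, Matrix.mulVec_smul, add_dotProduct, hs] at this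
    linarith
  have k1 := key 1
  have k2 := key (-1)
  rw [abs_le]
  constructor <;> linarith [hle i, hle j]

theorem quad_upper {n : ℕ} {Q : Matrix (Fin n) (Fin n) ℝ} {K : ℝ} (hK : ∀ i j, |Q i j| ≤ K) (v : Fin n → ℝ) :
    v ⬝ᵥ Q *ᵥ v ≤ n * K * (v ⬝ᵥ v) := by
  have h1 : v ⬝ᵥ Q *ᵥ v = ∑ i, ∑ j, v i * Q i j * v j := by
    simp [dotProduct, Matrix.mulVec, Finset.mul_sum, mul_assoc]
  have h2 : ∀ i j, v i * Q i j * v j ≤ K * ((v i ^ 2 + v j ^ 2) / 2) := by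
    intro i j
    have a : v i * Q i j * v j ≤ |Q i j| * (|v i| * |v j|) := by
      rw [← abs_mul, ← abs_mul]
      exact (le_abs_self _).trans (le_of_eq (by congr 1; ring))
    have b : |v i| * |v j| ≤ (v i ^ 2 + v j ^ 2) / 2 := by
      nlinarith [sq_nonneg (|v i| - |v j|), sq_abs (v i), sq_abs (v j)]
    exact a.trans (mul_le_mul (hK i j) b (by positivity) ((abs_nonneg _).trans (hK i j)))
  rw [h1]
  refine (Finset.sum_le_sum fun i _ => Finset.sum_le_sum fun j _ => h2 i j).trans (le_of_eq ?_)
  have h3 : v ⬝ᵥ v = ∑ i, v i ^ 2 := by simp [dotProduct, sq]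
  simp_rw [← Finset.mul_sum, ← Finset.sum_div, Finset.sum_add_distrib]
  rw [h3]
  simp [← Finset.mul_sum]
  ring

theorem quad_lower {n : ℕ} {M : Matrix (Fin n) (Fin n) ℝ} (hM : M.PosDef) {κ : ℝ} (hκ : 0 < κ)
    (hQ : ∀ v : Fin n → ℝ, v ⬝ᵥ M⁻¹ *ᵥ v ≤ κ * (v ⬝ᵥ v)) (v : Fin n → ℝ) :
    v ⬝ᵥ v ≤ κ * (v ⬝ᵥ M *ᵥ v) := by
  have hdet : IsUnit M.det := (Matrix.isUnit_iff_isUnit_det M).1 hM.isUnit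
  have hQp := hM.inv.posSemidef
  have h0 := hQp.dotProduct_mulVec_nonneg (v - κ • (M *ᵥ v))
  have e1 : M⁻¹ *ᵥ (M *ᵥ v) = v := by
    rw [Matrix.mulVec_mulVec, Matrix.nonsing_inv_mul _ hdet, Matrix.one_mulVec]
  have hMt : Mᵀ = M := by simpa using hM.isHermitian.eq
  have e2 : (M *ᵥ v) ⬝ᵥ (M⁻¹ *ᵥ v) = v ⬝ᵥ v := by
    rw [Matrix.dotProduct_mulVec, ← Matrix.mulVec_transpose, Matrix.transpose_nonsing_inv, hMt, e1]
  rw [star_trivial, Matrix.mulVec_sub, Matrix.mulVec_smul, e1] at h0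
  simp only [sub_dotProduct, dotProduct_sub, smul_dotProduct, dotProduct_smul, e2, smul_eq_mul] at h0
  have e3 : (M *ᵥ v) ⬝ᵥ v = v ⬝ᵥ M *ᵥ v := dotProduct_comm _ _
  rw [e3] at h0
  have := hQ v
  have h4 : 0 ≤ κ * (κ * (v ⬝ᵥ M *ᵥ v) - v ⬝ᵥ v) := by linarith
  have := nonneg_of_mul_nonneg_right h4 hκ
  linarith

theorem triple_bound {n : ℕ} {X Y Z : Matrix (Fin n) (Fin n) ℝ} {a b c : ℝ} (hX : ∀ i j, |X i j| ≤ a)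
    (hY : ∀ i j, |Y i j| ≤ b) (hZ : ∀ i j, |Z i j| ≤ c) (i j : Fin n) :
    |(X * Y * Z) i j| ≤ n ^ 2 * a * b * c := by
  have h : ∀ (X Y : Matrix (Fin n) (Fin n) ℝ) (a b : ℝ), (∀ i j, |X i j| ≤ a) → (∀ i j, |Y i j| ≤ b) → 
      ∀ i j, |(X * Y) i j| ≤ n * a * b := by
    intro X Y a b hX hY i j
    rw [Matrix.mul_apply]
    refine (Finset.abs_sum_le_sum_abs _ _).trans ?_
    refine (Finset.sum_le_sum fun k _ => show |X i k * Y k j| ≤ a * b from ?_).trans ?_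
    · rw [abs_mul]
      exact mul_le_mul (hX i k) (hY k j) (abs_nonneg _) ((abs_nonneg _).trans (hX i k))
    · simp [mul_assoc]
  refine (h _ _ _ _ (h X Y a b hX hY) hZ i j).trans (le_of_eq ?_)
  ring

theorem bdd_of_tendsto {n : ℕ} {g : EE n → ℝ} (hg : Continuous g) {l : ℝ}
    (hl : Tendsto g (cocompact _) (nhds l)) : ∃ F, 0 ≤ F ∧ ∀ x, |g x| ≤ F := by
  have h1 : ∀ᶠ x in cocompact (EE n), |g x| < |l| + 1 := by
    have := (continuous_abs.tendsto l).comp hl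
    exact this.eventually (gt_mem_nhds (by linarith))
  obtain ⟨K, hK, hKs⟩ := mem_cocompact.1 h1
  obtain ⟨F, hF⟩ := hK.exists_bound_of_continuousOn hg.continuousOn
  refine ⟨max (|l| + 1) F, le_max_of_le_left (by positivity), fun x => ?_⟩
  by_cases hx : x ∈ K
  · exact (hF x hx).trans (le_max_right _ _)
  · exact (le_of_lt (hKs hx)).trans (le_max_left _ _)


theorem strong_mono {n : ℕ} {T : EE n → EE n} {M : EE n → Matrix (Fin n) (Fin n) ℝ}
    (hT : ∀ x, HasFDerivAt T (Matrix.toEuclideanCLM (𝕜 := ℝ) (M x)) x) {κ : ℝ} (hκ : 0 < κ)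
    (hq : ∀ x (v : Fin n → ℝ), v ⬝ᵥ v ≤ κ * (v ⬝ᵥ M x *ᵥ v)) (x y : EE n) :
    ‖x - y‖ ^ 2 ≤ κ * inner ℝ (x - y) (T x - T y) := by
  set w := x - y with hw
  have hd : ∀ t : ℝ, HasDerivAt (fun t : ℝ => κ * inner ℝ w (T (y + t • w)) - t * ‖w‖ ^ 2)
      (κ * inner ℝ w (Matrix.toEuclideanCLM (𝕜 := ℝ) (M (y + t • w)) w) - ‖w‖ ^ 2) t := by
    intro t
    have h1 : HasDerivAt (fun t : ℝ => y + t • w) w t := by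
      simpa using ((hasDerivAt_id t).smul_const w).const_add y
    have h2 := (hT (y + t • w)).comp_hasDerivAt t h1
    have h3 := ((innerSL ℝ w).hasFDerivAt.comp_hasDerivAt t h2).const_mul κ
    have h4 := h3.sub ((hasDerivAt_id t).mul_const (‖w‖ ^ 2))
    have h5 : HasDerivAt (fun t : ℝ => κ * inner ℝ w (T (y + t • w)) - t * ‖w‖ ^ 2)
        (κ * inner ℝ w (Matrix.toEuclideanCLM (𝕜 := ℝ) (M (y + t • w)) w) - 1 * ‖w‖ ^ 2) t := h4
    rwa [one_mul] at h5
  have hm : Monotone (fun t : ℝ => κ * inner ℝ w (T (y + t • w)) - t * ‖w‖ ^ 2) := by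
    refine monotone_of_deriv_nonneg (fun t => (hd t).differentiableAt) fun t => ?_
    rw [(hd t).deriv, Matrix.inner_toEuclideanCLM]
    have := hq (y + t • w) w.ofLp
    have h5 : ‖w‖ ^ 2 = w.ofLp ⬝ᵥ w.ofLp := by
      rw [EuclideanSpace.real_norm_sq_eq]; simp [dotProduct, sq]
    rw [h5]
    simpa using this
  have := hm (zero_le_one)
  simp only [zero_smul, add_zero, one_smul, zero_mul, one_mul, sub_zero] at this
  have e : y + w = x := by simp [hw]
  rw [e] at this
  rw [inner_sub_right]
  linarith

theorem mono_of_nonneg {n : ℕ} {T : EE n → EE n} {M : EE n → Matrix (Fin n) (Fin n) ℝ}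
    (hT : ∀ x, HasFDerivAt T (Matrix.toEuclideanCLM (𝕜 := ℝ) (M x)) x)
    (hq : ∀ x (v : Fin n → ℝ), 0 ≤ v ⬝ᵥ M x *ᵥ v) (x y : EE n) :
    0 ≤ inner ℝ (x - y) (T x - T y) := by
  set w := x - y with hw
  have hd : ∀ t : ℝ, HasDerivAt (fun t : ℝ => inner ℝ w (T (y + t • w)))
      (inner ℝ w (Matrix.toEuclideanCLM (𝕜 := ℝ) (M (y + t • w)) w)) t := by
    intro t
    have h1 : HasDerivAt (fun t : ℝ => y + t • w) w t := by
      simpa using ((hasDerivAt_id t).smul_const w).const_add y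
    have h2 := (hT (y + t • w)).comp_hasDerivAt t h1
    exact (innerSL ℝ w).hasFDerivAt.comp_hasDerivAt t h2
  have hm : Monotone (fun t : ℝ => (inner ℝ w (T (y + t • w)) : ℝ)) := by
    refine monotone_of_deriv_nonneg (fun t => (hd t).differentiableAt) fun t => ?_
    rw [(hd t).deriv, Matrix.inner_toEuclideanCLM]
    simpa using hq (y + t • w) w.ofLp
  have := hm (zero_le_one)
  simp only [zero_smul, add_zero, one_smul] at this
  have e : y + w = x := by simp [hw]
  rw [e] at this
  rw [inner_sub_right]
  linarith

theorem legendre {n : ℕ} {T : EE n → EE n} {M : EE n → Matrix (Fin n) (Fin n) ℝ}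
    (hMc : Continuous M) (hM : ∀ x, (M x).PosDef)
    (hT : ∀ x, HasFDerivAt T (Matrix.toEuclideanCLM (𝕜 := ℝ) (M x)) x) {κ : ℝ} (hκ : 0 < κ)
    (hq : ∀ x (v : Fin n → ℝ), v ⬝ᵥ v ≤ κ * (v ⬝ᵥ M x *ᵥ v)) :
    ∃ S : EE n → EE n, (∀ x, S (T x) = x) ∧ (∀ y, T (S y) = y) ∧ (∀ x y, ‖x - y‖ ≤ κ * ‖T x - T y‖) ∧
      ∀ y, HasFDerivAt S (Matrix.toEuclideanCLM (𝕜 := ℝ) (M (S y))⁻¹) y := by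
  have hl : ∀ x y, ‖x - y‖ ≤ κ * ‖T x - T y‖ := by
    intro x y
    have h1 := strong_mono hT hκ hq x y
    have h2 := real_inner_le_norm (x - y) (T x - T y)
    rcases eq_or_lt_of_le (norm_nonneg (x - y)) with h | h
    · rw [← h]; positivity
    · have : ‖x - y‖ * ‖x - y‖ ≤ ‖x - y‖ * (κ * ‖T x - T y‖) := by nlinarith
      exact le_of_mul_le_mul_left this h
  have hinj : Function.Injective T := by
    intro x y h
    have := hl x y
    rw [h] at this
    simpa [sub_eq_zero] using this
  have hTc : Continuous T := continuous_iff_continuousAt.2 fun x => (hT x).continuousAt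
  have hanti : AntilipschitzWith κ.toNNReal T := by
    refine AntilipschitzWith.of_le_mul_dist fun x y => ?_
    rw [dist_eq_norm, dist_eq_norm, Real.coe_toNNReal _ hκ.le]
    exact hl x y
  have hLc : Continuous (fun x => Matrix.toEuclideanCLM (𝕜 := ℝ) (M x)) := by
    have : Continuous (Matrix.toEuclideanCLM (n := Fin n) (𝕜 := ℝ)) :=
      LinearMap.continuous_of_finiteDimensional
        ((Matrix.toEuclideanCLM (n := Fin n) (𝕜 := ℝ)).toAlgEquiv.toLinearMap)
    exact this.comp hMc
  have hst : ∀ x, HasStrictFDerivAt T (Matrix.toEuclideanCLM (𝕜 := ℝ) (M x)) x := fun x =>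
    hasStrictFDerivAt_of_hasFDerivAt_of_continuousAt (Eventually.of_forall hT) hLc.continuousAt
  have hu : ∀ x, IsUnit (M x).det := fun x => (Matrix.isUnit_iff_isUnit_det _).1 (hM x).isUnit
  let Eq : EE n → (EE n ≃L[ℝ] EE n) := fun x =>
    ContinuousLinearEquiv.equivOfInverse (Matrix.toEuclideanCLM (𝕜 := ℝ) (M x))
      (Matrix.toEuclideanCLM (𝕜 := ℝ) (M x)⁻¹)
      (fun v => by
        rw [← mul_apply_eq_comp, ← map_mul, Matrix.nonsing_inv_mul _ (hu x), map_one]; rfl)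
      (fun v => by
        rw [← mul_apply_eq_comp, ← map_mul, Matrix.mul_nonsing_inv _ (hu x), map_one]; rfl)
  have hopen : IsOpenMap T := isOpenMap_of_hasStrictFDerivAt_equiv (f' := Eq) hst
  have hproper : IsProperMap T := by
    rw [isProperMap_iff_tendsto_cocompact]
    refine ⟨hTc, ?_⟩
    rw [← Metric.cobounded_eq_cocompact]
    exact hanti.tendsto_cobounded
  have hsurj : Function.Surjective T := by
    have hclopen : IsClopen (Set.range T) :=
      ⟨hproper.isClosedMap.isClosed_range, hopen.isOpen_range⟩
    have := hclopen.eq_univ ⟨T 0, 0, rfl⟩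
    exact Set.range_eq_univ.1 this
  obtain ⟨S, hS⟩ := hsurj.hasRightInverse
  have hSl : ∀ x, S (T x) = x := fun x => hinj (hS (T x))
  have hScont : Continuous S := by
    refine LipschitzWith.continuous (K := κ.toNNReal) (LipschitzWith.of_dist_le_mul fun x y => ?_)
    rw [dist_eq_norm, dist_eq_norm, Real.coe_toNNReal _ hκ.le]
    have := hl (S x) (S y)
    rwa [hS x, hS y] at this
  refine ⟨S, hSl, hS, hl, fun y => ?_⟩
  have h1 : HasFDerivAt T ((Eq (S y) : EE n ≃L[ℝ] EE n) : EE n →L[ℝ] EE n) (S y) := hT (S y)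
  exact h1.of_local_left_inverse hScont.continuousAt (Eventually.of_forall hS)


theorem hess_apply {n : ℕ} (u : EE n → ℝ) (x : EE n) (i j : Fin n) :
    hess u x i j = fderiv ℝ (fderiv ℝ u) x (EuclideanSpace.single i 1) (EuclideanSpace.single j 1) := by
  simp [hess, iteratedFDeriv_two_apply]

theorem hess_continuous {n : ℕ} {u : EE n → ℝ} (hu : ContDiff ℝ 2 u) : Continuous (hess u) := by
  refine continuous_matrix fun i j => ?_
  simp_rw [hess_apply]
  have h1 : ContDiff ℝ 1 (fderiv ℝ u) := hu.fderiv_right (by norm_num)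
  have h2 : Continuous (fderiv ℝ (fderiv ℝ u)) := h1.continuous_fderiv (by norm_num)
  fun_prop

noncomputable def TT {n : ℕ} (u : EE n → ℝ) (x : EE n) : EE n :=
  WithLp.toLp 2 (fun j => pd j u x + x j)

theorem TT_hasFDerivAt {n : ℕ} {u : EE n → ℝ} (hu : ContDiff ℝ 2 u) (hsym : ∀ x, (hess u x).IsHermitian)
    (x : EE n) : HasFDerivAt (TT u) (Matrix.toEuclideanCLM (𝕜 := ℝ) (hess u x + 1)) x := by
  rw [← hasFDerivWithinAt_univ, hasFDerivWithinAt_euclidean]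
  intro j
  have h1 : ContDiff ℝ 1 (fderiv ℝ u) := hu.fderiv_right (by norm_num)
  have h2 : HasFDerivAt (fderiv ℝ u) (fderiv ℝ (fderiv ℝ u) x) x :=
    (h1.differentiable (by norm_num) x).hasFDerivAt
  have h3 := h2.clm_apply (hasFDerivAt_const (EuclideanSpace.single j (1 : ℝ)) x)
  have h4 := h3.add ((PiLp.proj (𝕜 := ℝ) 2 (fun _ : Fin n => ℝ) j).hasFDerivAt (x := x))
  rw [hasFDerivWithinAt_univ]
  refine (h4.congr_fderiv ?_)
  ext v
  have hv : v = ∑ i, v i • EuclideanSpace.single i (1 : ℝ) := by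
    ext k; simp [Finset.sum_apply, Pi.single_apply]
  have e : (fderiv ℝ (fderiv ℝ u) x v) (EuclideanSpace.single j 1) = ∑ i, hess u x j i * v i := by
    have : ∀ i, hess u x j i = hess u x i j := fun i => by simpa using ((hsym x).apply j i).symm
    simp_rw [this, hess_apply]
    conv_lhs => rw [hv]
    simp [mul_comm]
  simp [Matrix.ofLp_toEuclideanCLM, Matrix.add_mulVec, Matrix.mulVec, dotProduct, e]

theorem growth {n : ℕ} {v : EE n → ℝ} {T : EE n → EE n} (hv : ∀ x, HasFDerivAt v (innerSL ℝ (T x)) x)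
    (hm : ∀ x y, 0 ≤ inner ℝ (x - y) (T x - T y)) {C : ℝ} (hC : ∀ x, v x ≤ C * (1 + ‖x‖ ^ 2)) :
    ∃ C1, 1 ≤ C1 ∧ ∀ x, ‖T x‖ ≤ C1 * (1 + ‖x‖) := by
  have hconv : ∀ x h, v x + inner ℝ (T x) h ≤ v (x + h) := by
    intro x h
    have hd : ∀ t : ℝ, HasDerivAt (fun t : ℝ => v (x + t • h) - t * inner ℝ (T x) h)
        (inner ℝ (T (x + t • h)) h - 1 * inner ℝ (T x) h) t := by
      intro t
      have h1 : HasDerivAt (fun t : ℝ => x + t • h) h t := by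
        simpa using ((hasDerivAt_id t).smul_const h).const_add x
      have h2 := (hv (x + t • h)).comp_hasDerivAt t h1
      exact h2.sub ((hasDerivAt_id t).mul_const (inner ℝ (T x) h))
    have hm : MonotoneOn (fun t : ℝ => v (x + t • h) - t * inner ℝ (T x) h) (Set.Ici 0) := by
      refine monotoneOn_of_deriv_nonneg (convex_Ici 0) (fun t _ => (hd t).continuousAt.continuousWithinAt)
        (fun t _ => (hd t).differentiableAt.differentiableWithinAt) fun t ht => ?_
      rw [(hd t).deriv]
      have ht : 0 < t := by simpa using ht
      have := hm (x + t • h) x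
      rw [add_sub_cancel_left, inner_smul_left, inner_sub_right, real_inner_comm, real_inner_comm _ h] at this
      have := nonneg_of_mul_nonneg_right this (by simpa using ht)
      linarith
    have := hm (Set.mem_Ici.2 le_rfl) (Set.mem_Ici.2 zero_le_one) zero_le_one
    simp at this
    linarith
  refine ⟨5 * |C| + |v 0| + ‖T 0‖ + 1, by linarith [abs_nonneg C, abs_nonneg (v 0), norm_nonneg (T 0)], fun x => ?_⟩
  set r := 1 + ‖x‖ with hr
  have hr1 : 1 ≤ r := by simp [hr]
  rcases eq_or_lt_of_le (norm_nonneg (T x)) with h | h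
  · rw [← h]; positivity
  set w := (r / ‖T x‖) • T x with hw
  have hwn : ‖w‖ = r := by
    rw [hw, norm_smul, Real.norm_of_nonneg (by positivity)]; field_simp
  have hin : inner ℝ (T x) w = r * ‖T x‖ := by
    rw [hw, inner_smul_right, real_inner_self_eq_norm_sq]; field_simp
  have h1 := hconv x w
  have h2 := hC (x + w)
  have h3 : ‖x + w‖ ≤ 2 * r := by
    have := norm_add_le x w; rw [hwn] at this; linarith
  have h4 := hconv 0 x
  rw [zero_add] at h4
  have h5 : -(‖T 0‖ * ‖x‖) ≤ inner ℝ (T 0) x := by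
    have := abs_real_inner_le_norm (T 0) x
    linarith [neg_abs_le (inner ℝ (T 0) x : ℝ)]
  have h6 : C * (1 + ‖x + w‖ ^ 2) ≤ 5 * |C| * r ^ 2 := by
    have a : C * (1 + ‖x + w‖ ^ 2) ≤ |C| * (1 + ‖x + w‖ ^ 2) :=
      mul_le_mul_of_nonneg_right (le_abs_self C) (by positivity)
    have b : 1 + ‖x + w‖ ^ 2 ≤ 5 * r ^ 2 := by nlinarith [norm_nonneg (x + w)]
    have := mul_le_mul_of_nonneg_left b (abs_nonneg C)
    linarith
  have h7 : r * ‖T x‖ ≤ r * ((5 * |C| + |v 0| + ‖T 0‖ + 1) * r) := by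
    have a : |v 0| ≤ |v 0| * r ^ 2 := le_mul_of_one_le_right (abs_nonneg _) (by nlinarith)
    have b : ‖T 0‖ * ‖x‖ ≤ ‖T 0‖ * r ^ 2 := mul_le_mul_of_nonneg_left (by nlinarith) (norm_nonneg _)
    have := neg_abs_le (v 0)
    nlinarith
  exact le_of_mul_le_mul_left h7 (by linarith)

theorem v_hasFDerivAt {n : ℕ} {u : EE n → ℝ} (hu : ContDiff ℝ 2 u) (x : EE n) :
    HasFDerivAt (fun x => u x + ‖x‖ ^ 2 / 2) (innerSL ℝ (TT u x)) x := by
  have h1 : HasFDerivAt u (fderiv ℝ u x) x := (hu.differentiable (by norm_num) x).hasFDerivAt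
  have h2 : HasFDerivAt (fun x : EE n => ‖x‖ ^ 2) (2 • innerSL ℝ x) x := (hasStrictFDerivAt_norm_sq x).hasFDerivAt
  have h3 := h1.add (h2.mul_const (1 / 2))
  have h4 : HasFDerivAt (fun x => u x + ‖x‖ ^ 2 / 2) (fderiv ℝ u x + (1 / 2 : ℝ) • 2 • (innerSL ℝ) x) x :=
    h3.congr_of_eventuallyEq (Eventually.of_forall fun y => by simp [div_eq_mul_inv])
  refine h4.congr_fderiv ?_
  ext v
  have hv : v = ∑ i, v i • EuclideanSpace.single i (1 : ℝ) := by
    ext k; simp [Finset.sum_apply, Pi.single_apply]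
  have e : fderiv ℝ u x v = ∑ i, pd i u x * v i := by
    conv_lhs => rw [hv]
    simp [pd, mul_comm]
  simp [e, TT, PiLp.inner_apply, mul_comm, Finset.mul_sum]
  simp_rw [add_mul, Finset.sum_add_distrib]

theorem global_holder {n : ℕ} {α ζ' : ℝ} (hα₀ : 0 < α) (hζ' : 0 < ζ')
    {f : EE n → ℝ} {C R F : ℝ} (hC : 0 < C) (hR : 0 < R) (hF : ∀ x, |f x| ≤ F)
    (hf_holder : ∀ K : Set (EE n), IsCompact K →
      ∃ C : ℝ, ∀ x ∈ K, ∀ y ∈ K, |f x - f y| ≤ C * ‖x - y‖ ^ α)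
    (hd : ∀ x : EE n, R ≤ ‖x‖ → ∀ y ∈ Metric.closedBall x (‖x‖ / 2), ∀ z ∈ Metric.closedBall x (‖x‖ / 2),
        ‖x‖ ^ (α + ζ') * |f y - f z| ≤ C * ‖y - z‖ ^ α) :
    ∃ H, 0 ≤ H ∧ ∀ x y, |f x - f y| ≤ H * ‖x - y‖ ^ α := by
  have hF0 : 0 ≤ F := (abs_nonneg _).trans (hF 0)
  obtain ⟨C2, hC2⟩ := hf_holder (Metric.closedBall 0 (2 * R)) (isCompact_closedBall _ _)
  refine ⟨2 * F / (R / 2) ^ α + C / R ^ (α + ζ') + |C2|, by positivity, fun x y => ?_⟩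
  have hp : 0 ≤ ‖x - y‖ ^ α := by positivity
  have n1 : 0 ≤ 2 * F / (R / 2) ^ α * ‖x - y‖ ^ α := by positivity
  have n2 : 0 ≤ C / R ^ (α + ζ') * ‖x - y‖ ^ α := by positivity
  have n3 : 0 ≤ |C2| * ‖x - y‖ ^ α := by positivity
  rw [add_mul, add_mul]
  rcases le_or_gt (R / 2) ‖x - y‖ with h | h
  · have a : |f x - f y| ≤ 2 * F := by
      have := abs_sub (f x) (f y); linarith [hF x, hF y]
    have b : (R / 2) ^ α ≤ ‖x - y‖ ^ α := Real.rpow_le_rpow (by positivity) h hα₀.le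
    have : 2 * F ≤ 2 * F / (R / 2) ^ α * ‖x - y‖ ^ α := by
      rw [div_mul_eq_mul_div, le_div_iff₀ (by positivity)]
      exact mul_le_mul_of_nonneg_left b (by positivity)
    linarith
  rcases le_or_gt R ‖x‖ with hx | hx
  · have a := hd x hx x (Metric.mem_closedBall_self (by positivity)) y (by rw [Metric.mem_closedBall, dist_eq_norm, norm_sub_rev]; linarith)
    have b : R ^ (α + ζ') ≤ ‖x‖ ^ (α + ζ') := Real.rpow_le_rpow hR.le hx (by positivity)
    have : |f x - f y| ≤ C / R ^ (α + ζ') * ‖x - y‖ ^ α := by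
      rw [div_mul_eq_mul_div, le_div_iff₀ (by positivity)]
      have := mul_le_mul_of_nonneg_right b (abs_nonneg (f x - f y))
      linarith
    linarith
  · have hy : ‖y‖ ≤ 2 * R := by
      have := norm_sub_norm_le y x
      rw [norm_sub_rev] at this; linarith
    have a := hC2 x (by simp; linarith) y (by simpa using hy)
    have b := mul_le_mul_of_nonneg_right (le_abs_self C2) hp
    linarith


theorem rpow_neg_bound {c t s p a D : ℝ} (hc : 0 < c) (ht : 0 < t) (hs : c * t ≤ s) (hp : 0 < p) (ha : 0 ≤ a)
    (h : s ^ p * a ≤ D) : a ≤ D * c ^ (-p) * t ^ (-p) := by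
  have h1 : (c * t) ^ p ≤ s ^ p := Real.rpow_le_rpow (by positivity) hs hp.le
  have h2 : (c * t) ^ p * a ≤ D := (mul_le_mul_of_nonneg_right h1 ha).trans h
  rw [mul_assoc, ← Real.mul_rpow hc.le ht.le, Real.rpow_neg (by positivity), ← div_eq_mul_inv,
    le_div_iff₀ (by positivity)]
  linarith

theorem core1 {n : ℕ} (hn : 0 < n) {α ζ ζ' : ℝ} (hα : 0 < α) (hα1 : α < 1) (hζ : 0 < ζ) (hζ' : 0 < ζ')
    {T : EE n → EE n} {M : EE n → Matrix (Fin n) (Fin n) ℝ}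
    (hMc : Continuous M) (hM : ∀ x, (M x).PosDef)
    (hT : ∀ x, HasFDerivAt T (Matrix.toEuclideanCLM (𝕜 := ℝ) (M x)) x)
    {g : EE n → ℝ} (hg : ∀ x, (M x)⁻¹.trace = g x) {F H C R ginf C1 : ℝ} (hF : ∀ x, g x ≤ F)
    (hH0 : 0 ≤ H) (hH : ∀ x y, |g x - g y| ≤ H * ‖x - y‖ ^ α) (hC : 0 < C) (hR : 0 < R)
    (hd1 : ∀ x, R ≤ ‖x‖ → ‖x‖ ^ ζ * |g x - ginf| ≤ C)
    (hd2 : ∀ x, R ≤ ‖x‖ → ∀ z, ‖z - x‖ ≤ ‖x‖ / 2 → ‖x‖ ^ (α + ζ') * |g z - g x| ≤ C * ‖z - x‖ ^ α)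
    (hC1 : 1 ≤ C1) (hTg : ∀ x, ‖T x‖ ≤ C1 * (1 + ‖x‖)) :
    ∃ (S : EE n → EE n) (κ : ℝ), 0 < κ ∧ (∀ x, S (T x) = x) ∧ (∀ y, T (S y) = y) ∧
      (∀ x y, ‖x - y‖ ≤ κ * ‖T x - T y‖) ∧
      (∀ y, HasFDerivAt S (Matrix.toEuclideanCLM (𝕜 := ℝ) (M (S y))⁻¹) y) ∧
      (∀ y, 2 * C1 ≤ ‖y‖ → 1 / (2 * C1) * ‖y‖ ≤ ‖S y‖) ∧
      ∃ (B : Matrix (Fin n) (Fin n) ℝ) (C ε R' : ℝ), 0 < ε ∧ 0 ≤ C ∧ 1 ≤ R' ∧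
      (∀ i j y y', |(M (S y))⁻¹ i j - (M (S y'))⁻¹ i j| ≤ C * ‖y - y'‖ ^ α) ∧
      ∀ i j y, R' ≤ ‖y‖ → |(M (S y))⁻¹ i j - B i j| ≤ C * ‖y‖ ^ (-ε) := by
  have hent : ∀ x i j, |(M x)⁻¹ i j| ≤ F := fun x i j =>
    (psd_entry_le (hM x).inv.posSemidef i j).trans ((hg x).le.trans (hF x))
  have hF0 : 0 ≤ F := (abs_nonneg _).trans (hent 0 ⟨0, hn⟩ ⟨0, hn⟩)
  set κ : ℝ := n * F + 1 with hκd
  have hκ : 0 < κ := by positivity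
  have hvv : ∀ v : Fin n → ℝ, 0 ≤ v ⬝ᵥ v := fun v => by
    simp only [dotProduct]; exact Finset.sum_nonneg fun i _ => mul_self_nonneg _
  have hq : ∀ x (v : Fin n → ℝ), v ⬝ᵥ v ≤ κ * (v ⬝ᵥ M x *ᵥ v) := fun x v =>
    quad_lower (hM x) hκ (fun v => (quad_upper (hent x) v).trans (by nlinarith [hvv v])) v
  obtain ⟨S, hST, hTS, hl, hSd⟩ := legendre hMc hM hT hκ hq
  have hSl : ∀ x y, ‖S x - S y‖ ≤ κ * ‖x - y‖ := fun x y => by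
    have := hl (S x) (S y); rwa [hTS, hTS] at this
  have hSc : Continuous S := continuous_iff_continuousAt.2 fun x => (hSd x).continuousAt
  set c : ℝ := 1 / (2 * C1) with hc
  have hc0 : 0 < c := by positivity
  have hSg : ∀ y, 2 * C1 ≤ ‖y‖ → c * ‖y‖ ≤ ‖S y‖ := by
    intro y hy
    have := hTg (S y)
    rw [hTS] at this
    rw [hc, div_mul_eq_mul_div, div_le_iff₀ (by positivity)]
    nlinarith
  refine ⟨S, κ, hκ, hST, hTS, hl, hSd, hSg, ?_⟩
  have hinvc : Continuous fun y => (M (S y))⁻¹ := by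
    have hMS : Continuous fun y => M (S y) := hMc.comp hSc
    simp_rw [Matrix.inv_def, Ring.inverse_eq_inv']
    refine Continuous.smul (Continuous.inv₀ hMS.matrix_det fun y => ?_) hMS.matrix_adjugate
    exact (hM (S y)).det_pos.ne'
  have hpdd : ∀ j y, HasFDerivAt (fun y => S y j)
      ((PiLp.proj (𝕜 := ℝ) 2 (fun _ : Fin n => ℝ) j).comp (Matrix.toEuclideanCLM (𝕜 := ℝ) (M (S y))⁻¹)) y :=
    fun j y => (PiLp.proj (𝕜 := ℝ) 2 (fun _ : Fin n => ℝ) j).hasFDerivAt.comp y (hSd y)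
  have hpd : ∀ i j y, pd i (fun y => S y j) y = (M (S y))⁻¹ j i := by
    intro i j y
    rw [pd, (hpdd j y).fderiv]
    simp [Matrix.ofLp_toEuclideanCLM]
  have hsymm : ∀ x i j, (M x)⁻¹ i j = (M x)⁻¹ j i := fun x i j => by
    simpa using (hM x).inv.isHermitian.apply j i
  have hcd : ∀ k, ContDiff ℝ 1 (fun y => S y k) := by
    intro k
    rw [contDiff_one_iff_fderiv]
    refine ⟨fun y => (hpdd k y).differentiableAt, ?_⟩
    have : fderiv ℝ (fun y => S y k) = fun y => 
      ((PiLp.proj (𝕜 := ℝ) 2 (fun _ : Fin n => ℝ) k).comp (Matrix.toEuclideanCLM (𝕜 := ℝ) (M (S y))⁻¹)) :=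
      funext fun y => (hpdd k y).fderiv
    rw [this]
    have h1 : Continuous (Matrix.toEuclideanCLM (n := Fin n) (𝕜 := ℝ)) :=
      LinearMap.continuous_of_finiteDimensional
        ((Matrix.toEuclideanCLM (n := Fin n) (𝕜 := ℝ)).toAlgEquiv.toLinearMap)
    exact continuous_const.clm_comp (h1.comp hinvc)
  obtain ⟨B, C', ε, R', hε, -, hC', hR', hHol, hdec⟩ := potential hn hα hα1 hζ hζ' (s := fun k y => S y k) hcd
    (fun a b z => by rw [hpd, hpd, hsymm]) (K := F) (fun a b z => by rw [hpd]; exact hent _ _ _)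
    (h := fun y => g (S y)) (fun z => by simp_rw [hpd, ← hg]; rfl) (H := H * κ ^ α) (by positivity)
    (fun y z => by
      refine (hH _ _).trans ?_
      rw [mul_assoc, ← Real.mul_rpow hκ.le (norm_nonneg _)]
      exact mul_le_mul_of_nonneg_left (Real.rpow_le_rpow (norm_nonneg _) (hSl z y) hα.le) hH0)
    (hinf := ginf) (R := max (2 * C1) (R / c)) (δ := c / (2 * κ))
    (Cd := C * c ^ (-ζ) + C * κ ^ α * c ^ (-(α + ζ'))) (le_max_of_le_left (by linarith)) (by positivity) (by positivity)
    (fun y hy => by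
      have hy1 : 2 * C1 ≤ ‖y‖ := (le_max_left _ _).trans hy
      have hy2 : R / c ≤ ‖y‖ := (le_max_right _ _).trans hy
      have hy0 : 0 < ‖y‖ := by linarith
      rw [div_le_iff₀ hc0] at hy2
      have h1 := hSg y hy1
      have h2 := rpow_neg_bound hc0 hy0 h1 hζ (abs_nonneg _) (hd1 (S y) (by linarith))
      refine h2.trans (mul_le_mul_of_nonneg_right ?_ (by positivity))
      have : 0 ≤ C * κ ^ α * c ^ (-(α + ζ')) := by positivity
      linarith)
    (fun y hy z hz => by
      have hy1 : 2 * C1 ≤ ‖y‖ := (le_max_left _ _).trans hy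
      have hy2 : R / c ≤ ‖y‖ := (le_max_right _ _).trans hy
      have hy0 : 0 < ‖y‖ := by linarith
      rw [div_le_iff₀ hc0] at hy2
      have h1 := hSg y hy1
      have h3 : ‖S z - S y‖ ≤ ‖S y‖ / 2 := by
        refine (hSl z y).trans ((mul_le_mul_of_nonneg_left hz hκ.le).trans ?_)
        have : κ * (c / (2 * κ) * ‖y‖) = c * ‖y‖ / 2 := by field_simp
        rw [this]; linarith
      have h4 := hd2 (S y) (by linarith) (S z) h3
      have h5 : C * ‖S z - S y‖ ^ α ≤ C * κ ^ α * ‖z - y‖ ^ α := by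
        rw [mul_assoc, ← Real.mul_rpow hκ.le (norm_nonneg _)]
        exact mul_le_mul_of_nonneg_left (Real.rpow_le_rpow (norm_nonneg _) (hSl z y) hα.le) hC.le
      have h2 := rpow_neg_bound hc0 hy0 h1 (add_pos hα hζ') (abs_nonneg _) (h4.trans h5)
      refine h2.trans ?_
      have : 0 ≤ C * c ^ (-ζ) * ‖y‖ ^ (-(α + ζ')) * ‖z - y‖ ^ α := by positivity
      linarith)
  refine ⟨B, C', ε, R', hε, hC', hR', fun i j y y' => ?_, fun i j y hy => ?_⟩
  · have := hHol i j y y'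
    rwa [hpd, hpd, hsymm, hsymm _ j i] at this
  · have := hdec i j y hy
    rwa [hpd, hsymm] at this


theorem core2 {n : ℕ} (hn : 0 < n) {M : EE n → Matrix (Fin n) (Fin n) ℝ} (hM : ∀ x, (M x).PosDef)
    {g : EE n → ℝ} (hg : ∀ x, (M x)⁻¹.trace = g x) {ginf : ℝ} (hgl : Tendsto g (cocompact _) (nhds ginf))
    {S : EE n → EE n} {c r : ℝ} (hc : 0 < c)
    (hSd : ∀ y, HasFDerivAt S (Matrix.toEuclideanCLM (𝕜 := ℝ) (M (S y))⁻¹) y)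
    (hSg : ∀ y, r ≤ ‖y‖ → c * ‖y‖ ≤ ‖S y‖) {B : Matrix (Fin n) (Fin n) ℝ} {C ε R' : ℝ} (hε : 0 < ε)
    (hdec : ∀ i j y, R' ≤ ‖y‖ → |(M (S y))⁻¹ i j - B i j| ≤ C * ‖y‖ ^ (-ε)) :
    B.PosDef ∧ B.trace = ginf ∧ Tendsto (fun y => (M (S y))⁻¹) (cocompact _) (nhds B) := by
  have : Nonempty (Fin n) := ⟨⟨0, hn⟩⟩
  have : NoncompactSpace (EE n) := NormedSpace.noncompactSpace ℝ (EE n)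
  have hnorm : Tendsto (fun y : EE n => ‖y‖) (cocompact _) atTop := tendsto_norm_cocompact_atTop
  have hlim : Tendsto (fun y => (M (S y))⁻¹) (cocompact _) (nhds B) := by
    refine tendsto_pi_nhds.2 fun i => tendsto_pi_nhds.2 fun j => ?_
    rw [tendsto_iff_norm_sub_tendsto_zero]
    have h0 : Tendsto (fun y : EE n => C * ‖y‖ ^ (-ε)) (cocompact _) (nhds 0) := by
      simpa using ((tendsto_rpow_neg_atTop hε).comp hnorm).const_mul C
    refine squeeze_zero' (Eventually.of_forall fun y => norm_nonneg _) ?_ h0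
    filter_upwards [hnorm.eventually_ge_atTop R'] with y hy
    exact hdec i j y hy
  have hherm : B.IsHermitian := by
    have h1 : Tendsto (fun y => (M (S y))⁻¹ᴴ) (cocompact _) (nhds Bᴴ) :=
      ((continuous_id.matrix_conjTranspose).tendsto B).comp hlim
    have h2 : (fun y => (M (S y))⁻¹ᴴ) = fun y => (M (S y))⁻¹ := funext fun y => (hM (S y)).inv.isHermitian
    rw [h2] at h1
    exact tendsto_nhds_unique h1 hlim
  have hmv : ∀ v : Fin n → ℝ, Tendsto (fun y => (M (S y))⁻¹ *ᵥ v) (cocompact _) (nhds (B *ᵥ v)) := fun v =>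
    ((continuous_id.matrix_mulVec continuous_const).tendsto B).comp hlim
  have hpsd : B.PosSemidef := by
    refine Matrix.PosSemidef.of_dotProduct_mulVec_nonneg hherm fun v => ?_
    have h1 : Tendsto (fun y => star v ⬝ᵥ (M (S y))⁻¹ *ᵥ v) (cocompact _) (nhds (star v ⬝ᵥ B *ᵥ v)) :=
      ((continuous_const.dotProduct continuous_id).tendsto _).comp (hmv v)
    exact ge_of_tendsto h1 (Eventually.of_forall fun y => (hM (S y)).inv.posSemidef.dotProduct_mulVec_nonneg v)
  refine ⟨?_, ?_, hlim⟩
  · rw [hpsd.posDef_iff_isUnit, Matrix.isUnit_iff_isUnit_det, isUnit_iff_ne_zero]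
    intro hdet
    obtain ⟨v0, hv0, hBv⟩ := Matrix.exists_mulVec_eq_zero_iff.2 hdet
    set v : EE n := WithLp.toLp 2 v0 with hv
    have hvn : 0 < ‖v‖ := by
      rw [norm_pos_iff]; intro h; apply hv0
      have := congrArg WithLp.ofLp h
      simpa [hv] using this
    have hray : Tendsto (fun t : ℝ => ‖t • v‖) atTop atTop := by
      simp_rw [norm_smul]
      exact (tendsto_abs_atTop_atTop).atTop_mul_const hvn
    have hrayc : Tendsto (fun t : ℝ => t • v) atTop (cocompact _) := by
      rw [← Metric.cobounded_eq_cocompact]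
      exact tendsto_norm_atTop_iff_cobounded.1 hray
    have hz : Tendsto (fun t : ℝ => Matrix.toEuclideanCLM (𝕜 := ℝ) (M (S (t • v)))⁻¹ v) atTop (nhds 0) := by
      have h1 := (hmv v0).comp hrayc
      rw [hBv] at h1
      have h2 := ((PiLp.continuous_toLp 2 (fun _ : Fin n => ℝ)).tendsto 0).comp h1
      simpa [Function.comp_def, hv] using h2
    have hη : 0 < c * ‖v‖ / 2 := by positivity
    have hev : ∀ᶠ t : ℝ in atTop, ‖Matrix.toEuclideanCLM (𝕜 := ℝ) (M (S (t • v)))⁻¹ v‖ ≤ c * ‖v‖ / 2 := by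
      have := hz.norm
      rw [norm_zero] at this
      exact this.eventually_le_const hη
    obtain ⟨t1, ht1⟩ := eventually_atTop.1 (hev.and ((hray.eventually_ge_atTop r).and (eventually_gt_atTop 0)))
    have ht0 : 0 < t1 := (ht1 t1 le_rfl).2.2
    set K := ‖S (t1 • v)‖ with hK
    set t2 := t1 + 2 * K / (c * ‖v‖) with ht2
    have h12 : t1 ≤ t2 := by rw [ht2]; have : 0 ≤ 2 * K / (c * ‖v‖) := by positivity
                             linarith
    have hder : ∀ t : ℝ, HasDerivAt (fun t : ℝ => S (t • v)) (Matrix.toEuclideanCLM (𝕜 := ℝ) (M (S (t • v)))⁻¹ v) t := by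
      intro t
      have h1 : HasDerivAt (fun t : ℝ => t • v) v t := by simpa using (hasDerivAt_id t).smul_const v
      exact (hSd (t • v)).comp_hasDerivAt t h1
    have hmvt := Convex.norm_image_sub_le_of_norm_hasDerivWithin_le (f := fun t : ℝ => S (t • v))
      (s := Set.Ici t1) (fun t _ => (hder t).hasDerivWithinAt) (fun t ht => (ht1 t ht).1) (convex_Ici t1)
      (Set.mem_Ici.2 le_rfl) (Set.mem_Ici.2 h12)
    have hlow := hSg (t2 • v) (ht1 t2 h12).2.1
    rw [norm_smul, Real.norm_of_nonneg (by linarith : 0 ≤ t2)] at hlow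
    rw [Real.norm_of_nonneg (by linarith : 0 ≤ t2 - t1)] at hmvt
    have htri := norm_sub_norm_le (S (t2 • v)) (S (t1 • v))
    have e : c * ‖v‖ * (t2 - t1) = 2 * K := by rw [ht2]; field_simp; ring
    have : 0 < c * ‖v‖ * t1 := by positivity
    nlinarith
  · have h1 : Tendsto (fun y => (M (S y))⁻¹.trace) (cocompact _) (nhds B.trace) :=
      ((continuous_id.matrix_trace).tendsto B).comp hlim
    have hSc : Tendsto S (cocompact _) (cocompact _) := by
      rw [← Metric.cobounded_eq_cocompact]
      apply tendsto_norm_atTop_iff_cobounded.1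
      rw [Metric.cobounded_eq_cocompact]
      refine tendsto_atTop_mono' _ ?_ (hnorm.const_mul_atTop hc)
      filter_upwards [hnorm.eventually_ge_atTop r] with y hy
      exact hSg y hy
    have h2 := hgl.comp hSc
    refine tendsto_nhds_unique h1 ?_
    simp only [hg]
    exact h2

theorem core3 {n : ℕ} {α : ℝ} (hα : 0 < α)
    {T : EE n → EE n} {M : EE n → Matrix (Fin n) (Fin n) ℝ}
    (hMc : Continuous M) (hM : ∀ x, (M x).PosDef)
    (hT : ∀ x, HasFDerivAt T (Matrix.toEuclideanCLM (𝕜 := ℝ) (M x)) x)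
    {κ : ℝ} (hκ : 0 < κ) (hl : ∀ x y, ‖x - y‖ ≤ κ * ‖T x - T y‖)
    {P : EE n → Matrix (Fin n) (Fin n) ℝ} (hP : ∀ x, P (T x) = (M x)⁻¹)
    {B : Matrix (Fin n) (Fin n) ℝ} (hB : B.PosDef) (hlim : Tendsto P (cocompact _) (nhds B))
    {C ε R' : ℝ} (hε : 0 < ε) (hC : 0 ≤ C) (hR' : 1 ≤ R')
    (hHol : ∀ i j y y', |P y i j - P y' i j| ≤ C * ‖y - y'‖ ^ α)
    (hdec : ∀ i j y, R' ≤ ‖y‖ → |P y i j - B i j| ≤ C * ‖y‖ ^ (-ε)) :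
    ∃ C', 0 < C' ∧ (∀ x i j, |M x i j| ≤ C') ∧ (∀ x y i j, |M x i j - M y i j| ≤ C' * ‖x - y‖ ^ α) ∧
      ∀ x : EE n, 1 ≤ ‖x‖ → ∀ i j, |M x i j - B⁻¹ i j| ≤ C' * ‖x‖ ^ (-ε) := by
  have hu : ∀ x, IsUnit (M x).det := fun x => (Matrix.isUnit_iff_isUnit_det _).1 (hM x).isUnit
  have huB : IsUnit B.det := (Matrix.isUnit_iff_isUnit_det _).1 hB.isUnit
  have hTlow : ∀ x, ‖x‖ / κ - ‖T 0‖ ≤ ‖T x‖ := by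
    intro x
    have h1 := hl x 0
    rw [sub_zero] at h1
    have h2 := norm_sub_le (T x) (T 0)
    have : ‖x‖ / κ ≤ ‖T x - T 0‖ := by rw [div_le_iff₀ hκ]; linarith
    linarith
  have hnorm : Tendsto (fun y : EE n => ‖y‖) (cocompact _) atTop := tendsto_norm_cocompact_atTop
  have hTc : Tendsto T (cocompact _) (cocompact _) := by
    rw [← Metric.cobounded_eq_cocompact]
    apply tendsto_norm_atTop_iff_cobounded.1
    rw [Metric.cobounded_eq_cocompact]
    refine tendsto_atTop_mono hTlow ?_
    exact tendsto_atTop_add_const_right _ _ (hnorm.atTop_div_const hκ)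
  have hMl : Tendsto M (cocompact _) (nhds B⁻¹) := by
    have h1 := hlim.comp hTc
    have h2 : Tendsto (fun X : Matrix (Fin n) (Fin n) ℝ => X⁻¹) (nhds B) (nhds B⁻¹) := by
      simp_rw [Matrix.inv_def, Ring.inverse_eq_inv']
      have a : Tendsto (fun X : Matrix (Fin n) (Fin n) ℝ => X.det) (nhds B) (nhds B.det) :=
        (continuous_id.matrix_det).tendsto B
      have b : Tendsto (fun X : Matrix (Fin n) (Fin n) ℝ => X.adjugate) (nhds B) (nhds B.adjugate) :=
        (continuous_id.matrix_adjugate).tendsto B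
      exact (a.inv₀ huB.ne_zero).smul b
    have h3 := h2.comp h1
    refine h3.congr fun x => ?_
    simp only [Function.comp_apply, hP]
    exact Matrix.nonsing_inv_nonsing_inv _ (hu x)
  have hK : ∃ K, 0 ≤ K ∧ ∀ x i j, |M x i j| ≤ K := by
    have h1 : ∀ i j, ∃ F, 0 ≤ F ∧ ∀ x, |M x i j| ≤ F := fun i j =>
      bdd_of_tendsto (hMc.matrix_elem i j) (tendsto_pi_nhds.1 (tendsto_pi_nhds.1 hMl i) j)
    choose F hF0 hF using h1
    refine ⟨∑ i, ∑ j, F i j, Finset.sum_nonneg fun i _ => Finset.sum_nonneg fun j _ => hF0 i j, fun x i j => ?_⟩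
    refine (hF i j x).trans ?_
    refine (Finset.single_le_sum (f := fun j => F i j) (fun j _ => hF0 i j) (Finset.mem_univ j)).trans ?_
    exact Finset.single_le_sum (f := fun i => ∑ j, F i j) (fun i _ => Finset.sum_nonneg fun j _ => hF0 i j)
      (Finset.mem_univ i)
  obtain ⟨K1, hK10, hK1⟩ := hK
  obtain ⟨K2, hK20, hK2⟩ : ∃ K, 0 ≤ K ∧ ∀ i j, |B⁻¹ i j| ≤ K :=
    ⟨_, hB.inv.posSemidef.trace_nonneg, fun i j => psd_entry_le hB.inv.posSemidef i j⟩
  set K := K1 + K2 with hKd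
  have hK0 : 0 ≤ K := by positivity
  have hKM : ∀ x i j, |M x i j| ≤ K := fun x i j => (hK1 x i j).trans (by linarith)
  have hKB : ∀ i j, |B⁻¹ i j| ≤ K := fun i j => (hK2 i j).trans (by linarith)
  have hΦ : Continuous (Matrix.toEuclideanCLM (n := Fin n) (𝕜 := ℝ)) :=
    LinearMap.continuous_of_finiteDimensional
      ((Matrix.toEuclideanCLM (n := Fin n) (𝕜 := ℝ)).toAlgEquiv.toLinearMap)
  obtain ⟨L, hL0, hL⟩ := bdd_of_tendsto (g := fun x => ‖Matrix.toEuclideanCLM (𝕜 := ℝ) (M x)‖)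
    (hΦ.comp hMc).norm (((hΦ.tendsto _).comp hMl).norm)
  have hTL : ∀ x y, ‖T x - T y‖ ≤ L * ‖x - y‖ := fun x y =>
    Convex.norm_image_sub_le_of_norm_hasFDerivWithin_le (s := Set.univ)
      (fun z _ => (hT z).hasFDerivWithinAt) (fun z _ => (le_abs_self _).trans (hL z)) convex_univ
      (Set.mem_univ y) (Set.mem_univ x)
  have hhol : ∀ x y i j, |M x i j - M y i j| ≤ n ^ 2 * K * (C * L ^ α * ‖x - y‖ ^ α) * K := by
    intro x y i j
    have e : M x - M y = M x * ((M y)⁻¹ - (M x)⁻¹) * M y := by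
      rw [mul_sub, sub_mul, Matrix.mul_nonsing_inv _ (hu x), mul_assoc, Matrix.nonsing_inv_mul _ (hu y)]
      simp
    rw [← Matrix.sub_apply, e]
    refine triple_bound (hKM x) (fun i j => ?_) (hKM y) i j
    rw [Matrix.sub_apply, ← hP, ← hP]
    refine (hHol i j _ _).trans ?_
    rw [mul_assoc, ← Real.mul_rpow hL0 (norm_nonneg _)]
    refine mul_le_mul_of_nonneg_left (Real.rpow_le_rpow (norm_nonneg _) ?_ hα.le) hC
    rw [norm_sub_rev x y]; exact hTL y x
  have hrate : ∀ x i j, R' ≤ ‖T x‖ → |M x i j - B⁻¹ i j| ≤ n ^ 2 * K * (C * ‖T x‖ ^ (-ε)) * K := by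
    intro x i j hx
    have e : M x - B⁻¹ = M x * (B - (M x)⁻¹) * B⁻¹ := by
      rw [mul_sub, sub_mul, Matrix.mul_nonsing_inv _ (hu x), mul_assoc, Matrix.mul_nonsing_inv _ huB]
      simp
    rw [← Matrix.sub_apply, e]
    refine triple_bound (hKM x) (fun i j => ?_) hKB i j
    rw [Matrix.sub_apply, ← hP, abs_sub_comm]
    exact hdec i j _ hx
  set ρ := 2 * κ * (‖T 0‖ + R') with hρ
  have hρ0 : 0 < ρ := by positivity
  refine ⟨K + n ^ 2 * K * (C * L ^ α) * K + n ^ 2 * K * (C * (1 / (2 * κ)) ^ (-ε)) * K + 2 * K * ρ ^ ε + 1,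
    by positivity, fun x i j => ?_, fun x y i j => ?_, fun x hx i j => ?_⟩
  · refine (hKM x i j).trans ?_
    have : 0 ≤ n ^ 2 * K * (C * L ^ α) * K + n ^ 2 * K * (C * (1 / (2 * κ)) ^ (-ε)) * K + 2 * K * ρ ^ ε + 1 := by
      positivity
    linarith
  · refine (hhol x y i j).trans ?_
    have : 0 ≤ (K + n ^ 2 * K * (C * (1 / (2 * κ)) ^ (-ε)) * K + 2 * K * ρ ^ ε + 1) * ‖x - y‖ ^ α := by
      positivity
    linarith
  · have hx0 : 0 < ‖x‖ := by linarith
    rcases le_or_gt ρ ‖x‖ with h | h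
    · have h1 := hTlow x
      have h2 : ‖T 0‖ + R' ≤ ‖x‖ / (2 * κ) := by
        rw [le_div_iff₀ (by positivity)]; linarith
      have h3 : ‖x‖ / κ = 2 * (‖x‖ / (2 * κ)) := by field_simp
      have h4 : 1 / (2 * κ) * ‖x‖ ≤ ‖T x‖ := by
        rw [one_div_mul_eq_div]; linarith
      have h5 : R' ≤ ‖T x‖ := by linarith [norm_nonneg (T 0)]
      refine (hrate x i j h5).trans ?_
      have h6 : ‖T x‖ ^ (-ε) ≤ (1 / (2 * κ)) ^ (-ε) * ‖x‖ ^ (-ε) := by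
        rw [← Real.mul_rpow (by positivity) hx0.le]
        exact Real.rpow_le_rpow_of_nonpos (by positivity) h4 (by linarith)
      have h7 : n ^ 2 * K * (C * ‖T x‖ ^ (-ε)) * K ≤ n ^ 2 * K * (C * ((1 / (2 * κ)) ^ (-ε) * ‖x‖ ^ (-ε))) * K := by
        gcongr
      have : 0 ≤ (K + n ^ 2 * K * (C * L ^ α) * K + 2 * K * ρ ^ ε + 1) * ‖x‖ ^ (-ε) := by
        positivity
      linarith
    · have h1 : |M x i j - B⁻¹ i j| ≤ 2 * K := by
        have := abs_sub (M x i j) (B⁻¹ i j)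
        linarith [hKM x i j, hKB i j]
      have h2 : 1 ≤ ρ ^ ε * ‖x‖ ^ (-ε) := by
        rw [Real.rpow_neg hx0.le, ← div_eq_mul_inv, le_div_iff₀ (by positivity), one_mul]
        exact Real.rpow_le_rpow hx0.le h.le hε.le
      have h3 : 2 * K ≤ 2 * K * (ρ ^ ε * ‖x‖ ^ (-ε)) := le_mul_of_one_le_right (by positivity) h2
      have : 0 ≤ (K + n ^ 2 * K * (C * L ^ α) * K + n ^ 2 * K * (C * (1 / (2 * κ)) ^ (-ε)) * K + 1) * ‖x‖ ^ (-ε) := by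
        positivity
      linarith

/-- **Theorem 2.1, case τ = π/4**: if `u ∈ C²(ℝⁿ)` solves
`-√2 Σᵢ 1/(1+λᵢ(D²u)) = f` with `u ≤ C(1+|x|²)`, `D²u + I > 0`, `n ≥ 3`, `f` locally
`C^α`, and `limsup_{|x|→∞}(|x|^ζ|f - f(∞)| + |x|^{α+ζ'}[f]_{C^α(B̄_{|x|/2}(x))}) < ∞`
with `ζ > 0`, `ζ' > 0`, then `D²u` is globally bounded in `C^α` and converges at a
Hölder rate `C'|x|^{-ε}` to a symmetric matrix `A` with `A + I > 0` and
`-√2 Σᵢ 1/(1+λᵢ(A)) = f(∞)`. -/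
theorem hessian_convergence_tau_pi_div_four
    (n : ℕ) (hn : 3 ≤ n) (α ζ ζ' : ℝ) (hα₀ : 0 < α) (hα₁ : α < 1)
    (hζ : 0 < ζ) (hζ' : 0 < ζ')
    (f : EuclideanSpace ℝ (Fin n) → ℝ) (finf : ℝ)
    (hf_holder : ∀ K : Set (EuclideanSpace ℝ (Fin n)), IsCompact K →
      ∃ C : ℝ, ∀ x ∈ K, ∀ y ∈ K, |f x - f y| ≤ C * ‖x - y‖ ^ α)
    (hf_lim : Tendsto f (cocompact _) (nhds finf))
    (hf_decay : ∃ C R : ℝ, 0 < C ∧ 0 < R ∧ ∀ x : EuclideanSpace ℝ (Fin n), R ≤ ‖x‖ →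
      ‖x‖ ^ ζ * |f x - finf| ≤ C ∧
      ∀ y ∈ Metric.closedBall x (‖x‖ / 2), ∀ z ∈ Metric.closedBall x (‖x‖ / 2),
        ‖x‖ ^ (α + ζ') * |f y - f z| ≤ C * ‖y - z‖ ^ α)
    (u : EuclideanSpace ℝ (Fin n) → ℝ) (hu : ContDiff ℝ 2 u)
    (hsym : ∀ x, (hess u x).IsHermitian)
    (heq : ∀ x, -Real.sqrt 2 * ∑ i, 1 / (1 + (hsym x).eigenvalues i) = f x)
    (hgrow : ∃ C : ℝ, ∀ x : EuclideanSpace ℝ (Fin n), u x ≤ C * (1 + ‖x‖ ^ 2))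
    (hsemiconv : ∀ x, (hess u x + 1).PosDef) :
    ∃ (ε C' : ℝ) (A : Matrix (Fin n) (Fin n) ℝ) (hA : A.IsHermitian),
      0 < ε ∧ 0 < C' ∧ (A + 1).PosDef ∧
      (-Real.sqrt 2 * ∑ i, 1 / (1 + hA.eigenvalues i) = finf) ∧
      (∀ (x : EuclideanSpace ℝ (Fin n)) (i j : Fin n), |hess u x i j| ≤ C') ∧
      (∀ (x y : EuclideanSpace ℝ (Fin n)) (i j : Fin n),
        |hess u x i j - hess u y i j| ≤ C' * ‖x - y‖ ^ α) ∧
      (∀ x : EuclideanSpace ℝ (Fin n), 1 ≤ ‖x‖ → ∀ i j : Fin n,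
        |hess u x i j - A i j| ≤ C' * ‖x‖ ^ (-ε)) := by
  obtain ⟨C, R, hC, hR, hd⟩ := hf_decay
  have hn0 : 0 < n := by omega
  have hfc : Continuous f := by
    rw [continuous_iff_continuousAt]
    intro x
    obtain ⟨C0, hC0⟩ := hf_holder (Metric.closedBall x 1) (isCompact_closedBall _ _)
    rw [ContinuousAt, tendsto_iff_norm_sub_tendsto_zero]
    have h0 : Tendsto (fun y => C0 * ‖y - x‖ ^ α) (nhds x) (nhds 0) := by
      have h1 : Continuous (fun y => C0 * ‖y - x‖ ^ α) :=
        continuous_const.mul ((continuous_id.sub continuous_const).norm.rpow_const fun _ => Or.inr hα₀.le)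
      have := h1.tendsto x
      simpa [Real.zero_rpow hα₀.ne'] using this
    refine squeeze_zero' (Eventually.of_forall fun y => norm_nonneg _) ?_ h0
    filter_upwards [Metric.closedBall_mem_nhds x one_pos] with y hy
    exact hC0 y hy x (Metric.mem_closedBall_self zero_le_one)
  obtain ⟨F, hF0, hF⟩ := bdd_of_tendsto hfc hf_lim
  obtain ⟨H, hH0, hH⟩ := global_holder hα₀ hζ' hC hR hF hf_holder (fun x hx => (hd x hx).2)
  have h2 : 1 ≤ Real.sqrt 2 := Real.one_le_sqrt.2 (by norm_num)
  have h20 : 0 < Real.sqrt 2 := by linarith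
  have hgd : ∀ a b : ℝ, |-a / Real.sqrt 2 - -b / Real.sqrt 2| ≤ |a - b| := by
    intro a b
    have : -a / Real.sqrt 2 - -b / Real.sqrt 2 = -(a - b) / Real.sqrt 2 := by ring
    rw [this, abs_div, abs_neg, abs_of_pos h20]
    exact div_le_self (abs_nonneg _) h2
  have hMc : Continuous fun x => hess u x + 1 := (hess_continuous hu).add continuous_const
  have hT := TT_hasFDerivAt hu hsym
  have hg : ∀ x, (hess u x + 1)⁻¹.trace = -f x / Real.sqrt 2 := by
    intro x
    rw [← sum_eig_eq_trace (hsym x) (hsemiconv x), ← heq x]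
    field_simp
  have hmono : ∀ x y, 0 ≤ inner ℝ (x - y) (TT u x - TT u y) := by
    intro x y
    have h1 : ∀ x (v : Fin n → ℝ), 0 ≤ v ⬝ᵥ (hess u x + 1) *ᵥ v := fun x v => by
      simpa using (hsemiconv x).posSemidef.dotProduct_mulVec_nonneg v
    exact mono_of_nonneg hT h1 x y
  obtain ⟨Cu, hCu⟩ := hgrow
  obtain ⟨C1, hC1, hTg⟩ := growth (v_hasFDerivAt hu) hmono (C := Cu + 1 / 2) (fun x => by
    nlinarith [hCu x])
  have hgF : ∀ x, -f x / Real.sqrt 2 ≤ F := by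
    intro x
    rw [div_le_iff₀ h20]
    have := hF x
    rw [abs_le] at this
    nlinarith
  obtain ⟨S, κ, hκ, hST, hTS, hl, hSd, hSg, B, CB, ε, R', hε, hCB, hR', hHol, hdec⟩ :=
    core1 hn0 hα₀ hα₁ hζ hζ' hMc hsemiconv hT hg (ginf := -finf / Real.sqrt 2) hgF hH0
      (fun x y => (hgd _ _).trans (hH x y)) hC hR
      (fun x hx => (mul_le_mul_of_nonneg_left (hgd _ _) (by positivity)).trans (hd x hx).1)
      (fun x hx z hz => (mul_le_mul_of_nonneg_left (hgd _ _) (by positivity)).trans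
        ((hd x hx).2 z (by rwa [Metric.mem_closedBall, dist_eq_norm]) x
          (Metric.mem_closedBall_self (by positivity)))) hC1 hTg
  have hgl : Tendsto (fun x => -f x / Real.sqrt 2) (cocompact _) (nhds (-finf / Real.sqrt 2)) :=
    hf_lim.neg.div_const _
  obtain ⟨hB, hBt, hBl⟩ := core2 hn0 hsemiconv hg hgl (by positivity) hSd hSg hε hdec
  obtain ⟨C', hC', hb, hh, hr⟩ := core3 hα₀ hMc hsemiconv hT hκ hl (P := fun y => (hess u (S y) + 1)⁻¹)
    (fun x => by simp only [hST]) hB hBl hε hCB hR' hHol hdec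
  have hA : (B⁻¹ - 1).IsHermitian := hB.inv.isHermitian.sub Matrix.isHermitian_one
  have hA1 : B⁻¹ - 1 + 1 = B⁻¹ := by simp
  have hA2 : (B⁻¹ - 1 + 1).PosDef := by rw [hA1]; exact hB.inv
  refine ⟨ε, C' + 1, B⁻¹ - 1, hA, hε, by linarith, hA2, ?_, fun x i j => ?_, fun x y i j => ?_,
    fun x hx i j => ?_⟩
  · rw [sum_eig_eq_trace hA hA2, hA1,
      Matrix.nonsing_inv_nonsing_inv _ ((Matrix.isUnit_iff_isUnit_det _).1 hB.isUnit), hBt]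
    field_simp
  · have h1 := hb x i j
    have e : hess u x i j = (hess u x + 1) i j - (1 : Matrix (Fin n) (Fin n) ℝ) i j := by simp
    have h3 : |(1 : Matrix (Fin n) (Fin n) ℝ) i j| ≤ 1 := by
      rw [Matrix.one_apply]; split_ifs <;> simp
    rw [e]
    exact (abs_sub _ _).trans (by linarith)
  · have h1 := hh x y i j
    have e : hess u x i j - hess u y i j = (hess u x + 1) i j - (hess u y + 1) i j := by simp
    rw [e]
    have : 0 ≤ ‖x - y‖ ^ α := by positivity
    linarith
  · have h1 := hr x hx i j
    have e : hess u x i j - (B⁻¹ - 1) i j = (hess u x + 1) i j - B⁻¹ i j := by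
      simp only [Matrix.sub_apply, Matrix.add_apply]; ring
    rw [e]
    have : 0 ≤ ‖x‖ ^ (-ε) := by positivity
    linarith
end

section
/- Let n ≥ 3 and ζ > 2, and let f : ℝⁿ → ℝ be measurable with |f(y)| ≤ M(1+|y|)^{−ζ} for all y ∈ ℝⁿ and some constant M. Then there exists C > 0 such that for all x with |x| ≥ 2: ∫_{ℝⁿ} |x−y|^{2−n} |f(y)| dy ≤ C|x|^{2−min{n,ζ}} if ζ ≠ n, and ∫_{ℝⁿ} |x−y|^{2−n} |f(y)| dy ≤ C|x|^{2−n} ln|x| if ζ = n. -/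
open MeasureTheory

lemma radial_aux (n : ℕ) (hn : 3 ≤ n) : ∃ K : ℝ, 0 ≤ K ∧ ∀ g : ℝ → ENNReal, Measurable g →
    ∫⁻ y : EuclideanSpace ℝ (Fin n), g ‖y‖ =
      ENNReal.ofReal K * ∫⁻ r in Set.Ioi (0:ℝ), ENNReal.ofReal (r ^ (n-1)) * g r := by
  have : Nonempty (Fin n) := ⟨⟨0, by omega⟩⟩
  let μ : Measure (EuclideanSpace ℝ (Fin n)) := volume
  refine ⟨(μ.toSphere Set.univ).toReal, ENNReal.toReal_nonneg, fun g hg => ?_⟩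
  rw [ENNReal.ofReal_toReal (measure_ne_top _ _)]
  have h0 := μ.measurePreserving_homeomorphUnitSphereProd
  have hd : Module.finrank ℝ (EuclideanSpace ℝ (Fin n)) = n := by simp
  calc ∫⁻ y : EuclideanSpace ℝ (Fin n), g ‖y‖
      = ∫⁻ y in ({0}ᶜ : Set (EuclideanSpace ℝ (Fin n))), g ‖y‖ ∂μ := by
        rw [restrict_compl_singleton]
    _ = ∫⁻ y : ({0}ᶜ : Set (EuclideanSpace ℝ (Fin n))), g ‖y.1‖ ∂(μ.comap (↑)) :=
        (lintegral_subtype_comap (measurableSet_singleton _).compl (fun y => g ‖y‖)).symm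
    _ = ∫⁻ p, g (p.2 : ℝ) ∂(μ.toSphere.prod (.volumeIoiPow (Module.finrank ℝ (EuclideanSpace ℝ (Fin n)) - 1))) := by
        rw [← h0.lintegral_comp_emb (Homeomorph.measurableEmbedding _)]
        simp
    _ = μ.toSphere Set.univ * ∫⁻ r : Set.Ioi (0:ℝ), g r ∂(.volumeIoiPow (Module.finrank ℝ (EuclideanSpace ℝ (Fin n)) - 1)) := by
        rw [lintegral_prod _ (by fun_prop)]
        simp [mul_comm]
    _ = _ := by
        rw [hd, Measure.volumeIoiPow, lintegral_withDensity_eq_lintegral_mul _ (by fun_prop) (by fun_prop)]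
        congr 1
        exact lintegral_subtype_comap measurableSet_Ioi (fun r => ENNReal.ofReal (r ^ (n-1)) * g r)

lemma radial_set (n : ℕ) (K : ℝ) (h : ∀ g : ℝ → ENNReal, Measurable g →
    ∫⁻ y : EuclideanSpace ℝ (Fin n), g ‖y‖ =
      ENNReal.ofReal K * ∫⁻ r in Set.Ioi (0:ℝ), ENNReal.ofReal (r ^ (n-1)) * g r)
    (S : Set ℝ) (hS : MeasurableSet S) (φ ψ : ℝ → ℝ) (hφ : Measurable φ)
    (hle : ∀ r ∈ S ∩ Set.Ioi 0, r ^ (n-1) * φ r ≤ ψ r) (hψ0 : ∀ r ∈ S ∩ Set.Ioi 0, 0 ≤ ψ r)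
    (hψ : IntegrableOn ψ (S ∩ Set.Ioi 0)) :
    ∫⁻ y : EuclideanSpace ℝ (Fin n), S.indicator (fun r => ENNReal.ofReal (φ r)) ‖y‖ ≤
      ENNReal.ofReal K * ENNReal.ofReal (∫ r in S ∩ Set.Ioi 0, ψ r) := by
  rw [h _ ((by fun_prop : Measurable (fun r => ENNReal.ofReal (φ r))).indicator hS)]
  gcongr
  rw [ofReal_integral_eq_lintegral_ofReal hψ]
  swap
  · filter_upwards [ae_restrict_mem (hS.inter measurableSet_Ioi)] with r hr using hψ0 r hr
  rw [← Measure.restrict_restrict hS, ← lintegral_indicator hS]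
  refine setLIntegral_mono' measurableSet_Ioi fun r hr => ?_
  by_cases hrS : r ∈ S
  · simp only [Set.indicator_of_mem hrS]
    rw [← ENNReal.ofReal_mul (pow_nonneg (le_of_lt hr) _)]
    exact ENNReal.ofReal_le_ofReal (hle r ⟨hrS, hr⟩)
  · simp [Set.indicator_of_notMem hrS]

lemma pow_comb (n : ℕ) (hn : 3 ≤ n) (r a : ℝ) (hr : 0 < r) :
    r ^ (n-1) * r ^ a = r ^ ((n:ℝ) - 1 + a) := by
  rw [← Real.rpow_natCast, ← Real.rpow_add hr, Nat.cast_sub (by omega)]; norm_num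

/-- pointwise splitting -/
lemma pointwise_aux (n : ℕ) (hn : 3 ≤ n) (ζ : ℝ) (hζ : 2 < ζ)
    (x y : EuclideanSpace ℝ (Fin n)) (hx : 2 ≤ ‖x‖) :
    ENNReal.ofReal (‖x - y‖ ^ ((2 : ℝ) - n) * (1 + ‖y‖) ^ (-ζ)) ≤
     (ENNReal.ofReal ((‖x‖/2) ^ ((2:ℝ) - n)) *
        (Set.Iic (‖x‖/2)).indicator (fun r => ENNReal.ofReal ((1 + r) ^ (-ζ))) ‖y‖ +
      ENNReal.ofReal ((‖x‖/2) ^ (-ζ)) *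
        (Set.Iic (‖x‖/2)).indicator (fun r => ENNReal.ofReal (r ^ ((2:ℝ)-n))) ‖x - y‖) +
      ENNReal.ofReal ((3⁻¹:ℝ) ^ ((2:ℝ) - n)) *
        (Set.Ioi (‖x‖/2)).indicator (fun r => ENNReal.ofReal (r ^ ((2:ℝ)-n-ζ))) ‖y‖ := by
  have hn' : (3:ℝ) ≤ n := by exact_mod_cast hn
  have htri : ‖x‖ ≤ ‖x - y‖ + ‖y‖ := by simpa using norm_add_le (x - y) y
  have hy0 := norm_nonneg y
  by_cases h1 : ‖y‖ ≤ ‖x‖/2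
  · refine le_trans ?_ le_self_add
    refine le_trans ?_ le_self_add
    rw [Set.indicator_of_mem (by exact h1), ← ENNReal.ofReal_mul (by positivity)]
    apply ENNReal.ofReal_le_ofReal
    gcongr ?_ * _
    exact Real.rpow_le_rpow_of_nonpos (by linarith) (by linarith) (by linarith)
  · push Not at h1
    by_cases h2 : ‖x - y‖ ≤ ‖x‖/2
    · refine le_trans ?_ le_self_add
      refine le_trans ?_ le_add_self
      rw [Set.indicator_of_mem (by exact h2), ← ENNReal.ofReal_mul (by positivity), mul_comm]
      apply ENNReal.ofReal_le_ofReal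
      gcongr ?_ * _
      exact Real.rpow_le_rpow_of_nonpos (by linarith) (by linarith) (by linarith)
    · push Not at h2
      have htri2 : ‖y‖ ≤ ‖x - y‖ + ‖x‖ := by
        have := norm_sub_le x (x - y); simp at this; linarith
      refine le_trans ?_ le_add_self
      have hyp : 0 < ‖y‖ := by linarith
      rw [Set.indicator_of_mem (by exact h1), ← ENNReal.ofReal_mul (by positivity)]
      apply ENNReal.ofReal_le_ofReal
      rw [sub_eq_add_neg _ ζ, Real.rpow_add hyp, ← mul_assoc,
        ← Real.mul_rpow (by norm_num) hyp.le]
      gcongr ?_ * ?_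
      · exact Real.rpow_le_rpow_of_nonpos (by linarith) (by linarith) (by linarith)
      · exact Real.rpow_le_rpow_of_nonpos (by linarith) (by linarith) (by linarith)

lemma core (n : ℕ) (hn : 3 ≤ n) (ζ : ℝ) (hζ : 2 < ζ) : ∃ c : ℝ, 0 ≤ c ∧
    ∀ x : EuclideanSpace ℝ (Fin n), 2 ≤ ‖x‖ →
    ∫⁻ y, ENNReal.ofReal (‖x - y‖ ^ ((2 : ℝ) - n) * (1 + ‖y‖) ^ (-ζ)) ≤
      ENNReal.ofReal (c * (‖x‖ ^ ((2:ℝ) - n) * (∫ r in (0:ℝ)..(‖x‖/2), (1 + r) ^ ((n:ℝ) - 1 - ζ))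
        + ‖x‖ ^ (2 - ζ))) := by
  obtain ⟨K, hK, h⟩ := radial_aux n hn
  have hn' : (3:ℝ) ≤ n := by exact_mod_cast hn
  set a1 : ℝ := (2⁻¹:ℝ) ^ ((2:ℝ) - n) * K with ha1
  set a2 : ℝ := (2⁻¹:ℝ) ^ (2 - ζ) / 2 * K with ha2
  set a3 : ℝ := (3⁻¹:ℝ) ^ ((2:ℝ) - n) * ((2⁻¹:ℝ) ^ (2 - ζ) / (ζ - 2)) * K with ha3
  have hz : 0 < ζ - 2 := by linarith
  have p1 : 0 ≤ a1 := by positivity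
  have p2 : 0 ≤ a2 := by positivity
  have p3 : 0 ≤ a3 := by positivity
  refine ⟨a1 + a2 + a3, by positivity, fun x hx => ?_⟩
  set R := ‖x‖ with hR
  have hR0 : 0 < R := by linarith
  have hset : Set.Iic (R/2) ∩ Set.Ioi 0 = Set.Ioc 0 (R/2) := by
    ext; simp [and_comm]
  have hset' : Set.Ioi (R/2) ∩ Set.Ioi 0 = Set.Ioi (R/2) := by
    ext r; simp; intro; linarith
  set J := ∫ r in (0:ℝ)..(R/2), (1 + r) ^ ((n:ℝ) - 1 - ζ) with hJ
  have hJ0 : 0 ≤ J := intervalIntegral.integral_nonneg (by linarith) fun r hr =>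
    Real.rpow_nonneg (by linarith [hr.1]) _
  have hcont : ContinuousOn (fun r : ℝ => (1 + r) ^ ((n:ℝ) - 1 - ζ)) (Set.Icc 0 (R/2)) := by
    intro r hr
    exact ((continuousAt_const.add continuousAt_id).rpow_const
      (Or.inl (by simp; linarith [hr.1]))).continuousWithinAt
  have I1 := radial_set n K h (Set.Iic (R/2)) measurableSet_Iic (fun r => (1 + r) ^ (-ζ))
    (fun r => (1 + r) ^ ((n:ℝ) - 1 - ζ)) (by fun_prop) (by
      rintro r ⟨_, hr⟩
      simp only [Set.mem_Ioi] at hr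
      calc r ^ (n-1) * (1 + r) ^ (-ζ) ≤ (1 + r) ^ (n-1) * (1 + r) ^ (-ζ) := by
            gcongr; linarith
        _ = _ := by rw [pow_comb n hn _ _ (by linarith), sub_eq_add_neg _ ζ])
      (by rintro r ⟨_, hr⟩
          simp only [Set.mem_Ioi] at hr
          positivity)
      (by rw [hset]; exact (hcont.integrableOn_Icc).mono_set Set.Ioc_subset_Icc_self)
  rw [hset, ← intervalIntegral.integral_of_le (by linarith), ← hJ] at I1
  have I2 := radial_set n K h (Set.Iic (R/2)) measurableSet_Iic (fun r => r ^ ((2:ℝ) - n))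
    (fun r => r) (by fun_prop) (by
      rintro r ⟨_, hr⟩
      simp only [Set.mem_Ioi] at hr
      rw [pow_comb n hn _ _ hr]
      apply le_of_eq
      convert Real.rpow_one r using 2; ring)
      (by rintro r ⟨_, hr⟩; exact le_of_lt hr)
      (by rw [hset]; exact (continuousOn_id.integrableOn_Icc).mono_set Set.Ioc_subset_Icc_self)
  rw [hset, ← intervalIntegral.integral_of_le (by linarith), integral_id] at I2
  have I3 := radial_set n K h (Set.Ioi (R/2)) measurableSet_Ioi (fun r => r ^ ((2:ℝ) - n - ζ))
    (fun r => r ^ (1 - ζ)) (by fun_prop) (by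
      rintro r ⟨_, hr⟩
      simp only [Set.mem_Ioi] at hr
      rw [pow_comb n hn _ _ hr]
      apply le_of_eq
      congr 1; ring)
      (by rintro r ⟨_, hr⟩
          simp only [Set.mem_Ioi] at hr
          positivity)
      (by rw [hset']; exact integrableOn_Ioi_rpow_of_lt (by linarith) (by linarith))
  rw [hset', integral_Ioi_rpow_of_lt (by linarith) (by linarith)] at I3
  have m1 : Measurable (fun y : EuclideanSpace ℝ (Fin n) => (Set.Iic (R/2)).indicator (fun r => ENNReal.ofReal ((1 + r) ^ (-ζ))) ‖y‖) :=
    ((by fun_prop : Measurable (fun r : ℝ => ENNReal.ofReal ((1 + r) ^ (-ζ)))).indicator measurableSet_Iic).comp measurable_norm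
  have m2 : Measurable (fun y : EuclideanSpace ℝ (Fin n) => (Set.Iic (R/2)).indicator (fun r => ENNReal.ofReal (r ^ ((2:ℝ)-n))) ‖y‖) :=
    ((by fun_prop : Measurable (fun r : ℝ => ENNReal.ofReal (r ^ ((2:ℝ)-n)))).indicator measurableSet_Iic).comp measurable_norm
  have m2' : Measurable (fun y : EuclideanSpace ℝ (Fin n) => (Set.Iic (R/2)).indicator (fun r => ENNReal.ofReal (r ^ ((2:ℝ)-n))) ‖x - y‖) :=
    m2.comp (by fun_prop : Measurable fun y => x - y)
  have m3 : Measurable (fun y : EuclideanSpace ℝ (Fin n) => (Set.Ioi (R/2)).indicator (fun r => ENNReal.ofReal (r ^ ((2:ℝ)-n-ζ))) ‖y‖) :=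
    ((by fun_prop : Measurable (fun r : ℝ => ENNReal.ofReal (r ^ ((2:ℝ)-n-ζ)))).indicator measurableSet_Ioi).comp measurable_norm
  refine (lintegral_mono fun y => pointwise_aux n hn ζ hζ x y hx).trans ?_
  rw [← hR]
  rw [lintegral_add_right _ (m3.const_mul _),
    lintegral_add_left (m1.const_mul _), lintegral_const_mul _ m1, lintegral_const_mul _ m2',
    lintegral_const_mul _ m3, lintegral_sub_left_eq_self (fun y => (Set.Iic (R/2)).indicator (fun r => ENNReal.ofReal (r ^ ((2:ℝ)-n))) ‖y‖) x]
  refine (add_le_add (add_le_add (mul_le_mul_right I1 _) (mul_le_mul_right I2 _)) (mul_le_mul_right I3 _)).trans ?_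
  have q3 : 0 ≤ -(R / 2) ^ (1 - ζ + 1) / (1 - ζ + 1) := by
    have : 0 < (R / 2) ^ (1 - ζ + 1) := by positivity
    apply div_nonneg_of_nonpos <;> linarith
  have q2 : 0 ≤ ((R / 2) ^ 2 - 0 ^ 2) / 2 := by
    have : 0 < (R / 2) ^ 2 := by positivity
    linarith
  simp only [← ENNReal.ofReal_mul hK]
  rw [← ENNReal.ofReal_mul (by positivity), ← ENNReal.ofReal_mul (by positivity),
    ← ENNReal.ofReal_mul (by positivity), ← ENNReal.ofReal_add (by positivity) (by positivity),
    ← ENNReal.ofReal_add (by positivity) (by positivity)]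
  apply ENNReal.ofReal_le_ofReal
  have e1 : (R / 2) ^ ((2:ℝ) - n) * (K * J) = a1 * (R ^ ((2:ℝ) - n) * J) := by
    rw [div_eq_mul_inv, Real.mul_rpow hR0.le (by norm_num)]; ring
  have e0 : (R/2) ^ (2 - ζ) = (2⁻¹:ℝ) ^ (2 - ζ) * R ^ (2 - ζ) := by
    rw [div_eq_mul_inv, Real.mul_rpow hR0.le (by norm_num)]; ring
  have e2 : (R / 2) ^ (-ζ) * (K * (((R / 2) ^ 2 - 0 ^ 2) / 2)) = a2 * R ^ (2 - ζ) := by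
    have : (R/2) ^ (2 - ζ) = (R/2) ^ (-ζ) * (R/2)^2 := by
      rw [← Real.rpow_natCast, ← Real.rpow_add (by positivity)]; congr 1; push_cast; ring
    have e : a2 * R ^ (2 - ζ) = ((2⁻¹:ℝ) ^ (2 - ζ) * R ^ (2 - ζ)) / 2 * K := by rw [ha2]; ring
    rw [e, ← e0, this]; ring
  have e3 : (3⁻¹:ℝ) ^ ((2:ℝ) - n) * (K * (-(R / 2) ^ (1 - ζ + 1) / (1 - ζ + 1))) = a3 * R ^ (2 - ζ) := by
    have : 1 - ζ + 1 = -(ζ - 2) := by ring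
    have h' : 1 - ζ + 1 = 2 - ζ := by ring
    rw [neg_div, ← div_neg]
    rw [show -(1 - ζ + 1) = ζ - 2 by ring, h', e0, ha3]; ring
  rw [e1, e2, e3]
  have t1 : 0 ≤ R ^ ((2:ℝ) - n) * J := by positivity
  have t2 : 0 ≤ R ^ (2 - ζ) := by positivity
  nlinarith [mul_nonneg p1 t1, mul_nonneg p2 t1, mul_nonneg p3 t1, mul_nonneg p1 t2]

/-- **Decay estimate for the Newtonian-type potential (Lemma 3.2)** -/
theorem newtonian_potential_decay
    (n : ℕ) (hn : 3 ≤ n) (ζ : ℝ) (hζ : 2 < ζ)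
    (f : EuclideanSpace ℝ (Fin n) → ℝ) (hf_meas : Measurable f)
    (M : ℝ) (hf_bound : ∀ y : EuclideanSpace ℝ (Fin n), |f y| ≤ M * (1 + ‖y‖) ^ (-ζ)) :
    ∃ C : ℝ, 0 < C ∧
      ((ζ ≠ n → ∀ x : EuclideanSpace ℝ (Fin n), 2 ≤ ‖x‖ →
        ∫⁻ y, ENNReal.ofReal (‖x - y‖ ^ ((2 : ℝ) - n) * |f y|) ∂volume
          ≤ ENNReal.ofReal (C * ‖x‖ ^ ((2 : ℝ) - min (n : ℝ) ζ))) ∧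
      (ζ = n → ∀ x : EuclideanSpace ℝ (Fin n), 2 ≤ ‖x‖ →
        ∫⁻ y, ENNReal.ofReal (‖x - y‖ ^ ((2 : ℝ) - n) * |f y|) ∂volume
          ≤ ENNReal.ofReal (C * ‖x‖ ^ ((2 : ℝ) - n) * Real.log ‖x‖))) := by
  have hM : 0 ≤ M := by
    have := (abs_nonneg _).trans (hf_bound 0)
    simpa using this
  obtain ⟨c, hc, h⟩ := core n hn ζ hζ
  have key : ∀ x : EuclideanSpace ℝ (Fin n), 2 ≤ ‖x‖ →
      ∫⁻ y, ENNReal.ofReal (‖x - y‖ ^ ((2 : ℝ) - n) * |f y|) ≤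
      ENNReal.ofReal (M * c * (‖x‖ ^ ((2:ℝ) - n) * (∫ r in (0:ℝ)..(‖x‖/2), (1 + r) ^ ((n:ℝ) - 1 - ζ))
        + ‖x‖ ^ (2 - ζ))) := by
    intro x hx
    calc _ ≤ ∫⁻ y, ENNReal.ofReal M * ENNReal.ofReal (‖x - y‖ ^ ((2 : ℝ) - n) * (1 + ‖y‖) ^ (-ζ)) := by
          refine lintegral_mono fun y => ?_
          rw [← ENNReal.ofReal_mul hM]
          apply ENNReal.ofReal_le_ofReal
          calc _ ≤ ‖x - y‖ ^ ((2 : ℝ) - n) * (M * (1 + ‖y‖) ^ (-ζ)) := by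
                gcongr; exact hf_bound y
            _ = _ := by ring
      _ = ENNReal.ofReal M * ∫⁻ y, ENNReal.ofReal (‖x - y‖ ^ ((2 : ℝ) - n) * (1 + ‖y‖) ^ (-ζ)) :=
          lintegral_const_mul' _ _ ENNReal.ofReal_ne_top
      _ ≤ _ := by
          rw [mul_assoc, ENNReal.ofReal_mul hM]
          gcongr
          exact h x hx
  have hJint : ∀ (R a : ℝ), ∫ r in (0:ℝ)..R/2, (1 + r) ^ a = ∫ r in (1:ℝ)..(1+R/2), r ^ a := by
    intro R a
    have := intervalIntegral.integral_comp_add_left (a := 0) (b := R/2) (fun r : ℝ => r ^ a) 1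
    simpa using this
  by_cases hzn : ζ = n
  · refine ⟨M * c * (1 + 1 / Real.log 2) + 1, ?_, fun h' => absurd hzn h', fun _ x hx => ?_⟩
    · have := Real.log_pos (by norm_num : (1:ℝ) < 2)
      positivity
    refine (key x hx).trans (ENNReal.ofReal_le_ofReal ?_)
    have hl2 := Real.log_pos (by norm_num : (1:ℝ) < 2)
    have hlog : Real.log 2 ≤ Real.log ‖x‖ := Real.log_le_log (by norm_num) hx
    rw [hJint, show (n:ℝ) - 1 - ζ = -1 by rw [hzn]; ring]
    simp only [Real.rpow_neg_one]
    rw [integral_inv_of_pos (by norm_num) (by positivity), div_one, hzn]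
    have h1 : Real.log (1 + ‖x‖/2) ≤ Real.log ‖x‖ := Real.log_le_log (by positivity) (by linarith)
    have h2 : 1 ≤ 1 / Real.log 2 * Real.log ‖x‖ := by
      rw [div_mul_eq_mul_div, one_mul, le_div_iff₀ hl2]; linarith
    have hp : 0 < ‖x‖ ^ ((2:ℝ) - n) := by positivity
    calc M * c * (‖x‖ ^ ((2:ℝ) - n) * Real.log (1 + ‖x‖/2) + ‖x‖ ^ ((2:ℝ) - n))
        ≤ M * c * (‖x‖ ^ ((2:ℝ) - n) * Real.log ‖x‖ + ‖x‖ ^ ((2:ℝ) - n) * (1 / Real.log 2 * Real.log ‖x‖)) := by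
          gcongr
          exact le_mul_of_one_le_right hp.le h2
      _ ≤ M * c * (‖x‖ ^ ((2:ℝ) - n) * Real.log ‖x‖ + ‖x‖ ^ ((2:ℝ) - n) * (1 / Real.log 2 * Real.log ‖x‖)) + ‖x‖ ^ ((2:ℝ) - n) * Real.log ‖x‖ :=
          le_add_of_nonneg_right (mul_nonneg hp.le (by linarith))
      _ = _ := by ring
  · have hne : 0 < |(n:ℝ) - ζ| := abs_pos.mpr (sub_ne_zero.mpr (Ne.symm hzn))
    refine ⟨M * c * (1 / |(n:ℝ) - ζ| + 1) + 1, by positivity, fun _ x hx => ?_, fun h' => absurd h' hzn⟩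
    refine (key x hx).trans (ENNReal.ofReal_le_ofReal ?_)
    have hR0 : 0 < ‖x‖ := by linarith
    have hJ : ∫ r in (0:ℝ)..(‖x‖/2), (1 + r) ^ ((n:ℝ) - 1 - ζ) ≤ 1 / |(n:ℝ) - ζ| * ‖x‖ ^ ((n:ℝ) - min (n:ℝ) ζ) := by
      rw [hJint, integral_rpow (Or.inr ⟨fun h' => hzn (by linarith), by
        rw [Set.uIcc_of_le (by linarith)]; intro h'; linarith [h'.1]⟩)]
      rw [show (n:ℝ) - 1 - ζ + 1 = n - ζ by ring, Real.one_rpow, div_mul_eq_mul_div, one_mul]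
      rcases lt_or_gt_of_ne hzn with hlt | hgt
      · rw [min_eq_right hlt.le, abs_of_pos (by linarith)]
        have : (1 + ‖x‖/2) ^ ((n:ℝ) - ζ) ≤ ‖x‖ ^ ((n:ℝ) - ζ) :=
          Real.rpow_le_rpow (by positivity) (by linarith) (by linarith)
        have hd : 0 ≤ (n:ℝ) - ζ := by linarith
        gcongr
        linarith
      · rw [min_eq_left hgt.le, abs_of_neg (by linarith), sub_self, Real.rpow_zero]
        rw [show ((1 + ‖x‖/2) ^ ((n:ℝ) - ζ) - 1) / (n - ζ) = (1 - (1 + ‖x‖/2) ^ ((n:ℝ) - ζ)) / (ζ - n) by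
          rw [← neg_sub 1, ← neg_sub ζ, neg_div_neg_eq]]
        rw [show (n:ℝ) - ζ = -(ζ - n) by ring, neg_neg]
        have hd : 0 ≤ ζ - n := by linarith
        have : 0 ≤ (1 + ‖x‖/2) ^ (-(ζ - n)) := by positivity
        gcongr
        linarith
    have hmin : ‖x‖ ^ (2 - ζ) ≤ ‖x‖ ^ ((2:ℝ) - min (n:ℝ) ζ) :=
      Real.rpow_le_rpow_of_exponent_le (by linarith) (by linarith [min_le_right (n:ℝ) ζ])
    have hp : 0 < ‖x‖ ^ ((2:ℝ) - min (n:ℝ) ζ) := by positivity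
    calc _ ≤ M * c * (‖x‖ ^ ((2:ℝ) - n) * (1 / |(n:ℝ) - ζ| * ‖x‖ ^ ((n:ℝ) - min (n:ℝ) ζ)) + ‖x‖ ^ ((2:ℝ) - min (n:ℝ) ζ)) := by
          gcongr
      _ = M * c * (1 / |(n:ℝ) - ζ| + 1) * ‖x‖ ^ ((2:ℝ) - min (n:ℝ) ζ) := by
          have : ‖x‖ ^ ((2:ℝ) - min (n:ℝ) ζ) = ‖x‖ ^ ((2:ℝ) - n) * ‖x‖ ^ ((n:ℝ) - min (n:ℝ) ζ) := by
            rw [← Real.rpow_add hR0]; congr 1; ring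
          rw [this]; ring
      _ ≤ _ := by linarith
end

section
/- Define f : ℝⁿ → ℝ by f(x) = e^{−|x|} sin(e^{|x|}). Then for every α ∈ (0,1) and every ζ > 0, ζ' > 0, one has limsup_{|x|→∞} ( |x|^ζ |f(x)| + |x|^{α+ζ'} [f]_{C^α(B̄_{|x|/2}(x))} ) < ∞; in particular, there exists C > 0 such that for every R > 1, every x with |x| = R, and all z₁ ≠ z₂ in B̄_{R/2}(x), |f(z₁) − f(z₂)| / |z₁ − z₂|^α decays faster than any negative power of R as R → ∞. -/
theorem aux_lip (s t : ℝ) (hs : 0 ≤ s) (ht : 0 ≤ t) :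
    |Real.exp (-s) * Real.sin (Real.exp s) - Real.exp (-t) * Real.sin (Real.exp t)|
      ≤ 2 * |s - t| := by
  have h := (convex_Ici (0 : ℝ)).norm_image_sub_le_of_norm_hasDerivWithin_le
    (f := fun u : ℝ => Real.exp (-u) * Real.sin (Real.exp u))
    (f' := fun u : ℝ => (Real.exp (-u) * (-1)) * Real.sin (Real.exp u)
      + Real.exp (-u) * (Real.cos (Real.exp u) * Real.exp u)) (C := 2) (x := t) (y := s)
    (fun u _ => (((hasDerivAt_neg u).exp).mul ((Real.hasDerivAt_exp u).sin)).hasDerivWithinAt)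
    ?_ ht hs
  · simpa using h
  · intro u hu
    have hu : (0 : ℝ) ≤ u := hu
    have h1 : Real.exp (-u) ≤ 1 := Real.exp_le_one_iff.2 (by linarith)
    have h2 : Real.exp (-u) * Real.exp u = 1 := by rw [← Real.exp_add]; simp
    have e : (Real.exp (-u) * (-1)) * Real.sin (Real.exp u)
      + Real.exp (-u) * (Real.cos (Real.exp u) * Real.exp u)
      = -(Real.exp (-u) * Real.sin (Real.exp u)) + Real.cos (Real.exp u) := by
      linear_combination Real.cos (Real.exp u) * h2
    rw [e]
    refine (norm_add_le _ _).trans ?_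
    have h3 : ‖-(Real.exp (-u) * Real.sin (Real.exp u))‖ ≤ 1 := by
      rw [norm_neg, norm_mul, Real.norm_eq_abs, Real.norm_eq_abs, Real.abs_exp]
      exact mul_le_one₀ h1 (abs_nonneg _) (Real.abs_sin_le_one _)
    have h4 : ‖Real.cos (Real.exp u)‖ ≤ 1 := Real.abs_cos_le_one _
    linarith

/-- **Remark 2.6 example**: the function `f(x) = e^{-|x|} sin(e^{|x|})` satisfies the
Hölder-type decay condition `limsup_{|x|→∞}(|x|^ζ|f| + |x|^{α+ζ'}[f]_{C^α(B̄_{|x|/2}(x))})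
< ∞` for every `α ∈ (0,1)` and every `ζ, ζ' > 0` (note `f(∞) = 0`). -/
theorem example_holder_decay
    (n : ℕ) (hn : 1 ≤ n)
    (f : EuclideanSpace ℝ (Fin n) → ℝ)
    (hf : ∀ x : EuclideanSpace ℝ (Fin n), f x = Real.exp (-‖x‖) * Real.sin (Real.exp ‖x‖))
    (α ζ ζ' : ℝ) (hα₀ : 0 < α) (hα₁ : α < 1) (hζ : 0 < ζ) (hζ' : 0 < ζ') :
    ∃ C R : ℝ, 0 < C ∧ 0 < R ∧ ∀ x : EuclideanSpace ℝ (Fin n), R ≤ ‖x‖ →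
      ‖x‖ ^ ζ * |f x| ≤ C ∧
      ∀ z₁ ∈ Metric.closedBall x (‖x‖ / 2), ∀ z₂ ∈ Metric.closedBall x (‖x‖ / 2),
        ‖x‖ ^ (α + ζ') * |f z₁ - f z₂| ≤ C * ‖z₁ - z₂‖ ^ α := by
  have hc : 0 < (1 - α) / 2 := by linarith
  have t1 := (tendsto_rpow_mul_exp_neg_mul_atTop_nhds_zero ζ 1 one_pos).eventually
    (ge_mem_nhds (zero_lt_one' ℝ))
  have t2 := (tendsto_rpow_mul_exp_neg_mul_atTop_nhds_zero (α + ζ') ((1 - α) / 2) hc).eventually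
    (ge_mem_nhds (zero_lt_one' ℝ))
  obtain ⟨R, hR⟩ := Filter.eventually_atTop.1 (t1.and t2)
  have hfb : ∀ z, |f z| ≤ Real.exp (-‖z‖) := by
    intro z
    rw [hf, abs_mul, Real.abs_exp]
    exact mul_le_of_le_one_right (Real.exp_pos _).le (Real.abs_sin_le_one _)
  refine ⟨2, max R 1, by norm_num, by positivity, fun x hx => ?_⟩
  obtain ⟨h1, h2⟩ := hR ‖x‖ ((le_max_left _ _).trans hx)
  constructor
  · have := mul_le_mul_of_nonneg_left (hfb x) (Real.rpow_nonneg (norm_nonneg x) ζ)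
    rw [neg_one_mul] at h1
    linarith
  · intro z₁ hz₁ z₂ hz₂
    have hz : ∀ z ∈ Metric.closedBall x (‖x‖ / 2), |f z| ≤ Real.exp (-(‖x‖ / 2)) := by
      intro z hz
      refine (hfb z).trans (Real.exp_le_exp.2 ?_)
      rw [mem_closedBall_iff_norm'] at hz
      have := norm_sub_norm_le x z
      linarith
    have d1 : |f z₁ - f z₂| ≤ 2 * Real.exp (-(‖x‖ / 2)) := by
      have := abs_sub (f z₁) (f z₂)
      have := hz z₁ hz₁
      have := hz z₂ hz₂
      linarith
    have d2 : |f z₁ - f z₂| ≤ 2 * ‖z₁ - z₂‖ := by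
      rw [hf, hf]
      refine (aux_lip _ _ (norm_nonneg _) (norm_nonneg _)).trans ?_
      have := abs_norm_sub_norm_le z₁ z₂
      linarith
    have hD := abs_nonneg (f z₁ - f z₂)
    have key : |f z₁ - f z₂| ≤ 2 * ‖z₁ - z₂‖ ^ α * Real.exp (-((1 - α) / 2) * ‖x‖) := by
      calc |f z₁ - f z₂| = |f z₁ - f z₂| ^ α * |f z₁ - f z₂| ^ (1 - α) := by
            rw [← Real.rpow_add_of_nonneg hD hα₀.le (by linarith)]; simp
        _ ≤ (2 * ‖z₁ - z₂‖) ^ α * (2 * Real.exp (-(‖x‖ / 2))) ^ (1 - α) := by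
            have : 0 ≤ 1 - α := by linarith
            gcongr
        _ = ((2:ℝ) ^ α * 2 ^ (1 - α)) * ‖z₁ - z₂‖ ^ α * Real.exp (-((1 - α) / 2) * ‖x‖) := by
            rw [Real.mul_rpow (by norm_num) (norm_nonneg _),
              Real.mul_rpow (by norm_num) (Real.exp_pos _).le, ← Real.exp_mul]
            rw [show -(‖x‖ / 2) * (1 - α) = -((1 - α) / 2) * ‖x‖ by ring]
            ring
        _ = _ := by
            rw [← Real.rpow_add (by norm_num)]; simp
    calc ‖x‖ ^ (α + ζ') * |f z₁ - f z₂|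
        ≤ ‖x‖ ^ (α + ζ') * (2 * ‖z₁ - z₂‖ ^ α * Real.exp (-((1 - α) / 2) * ‖x‖)) := by gcongr
      _ = (2 * ‖z₁ - z₂‖ ^ α) * (‖x‖ ^ (α + ζ') * Real.exp (-((1 - α) / 2) * ‖x‖)) := by ring
      _ ≤ (2 * ‖z₁ - z₂‖ ^ α) * 1 := by gcongr
      _ = _ := by ring
end
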